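/- arXiv:1803.05711 — 8 statements merged into one kernel-verified Lean document; each statement's English description precedes it below -/
import Mathlib

section
/- Let a, b > 0, c = a/b, and r, R > 1. There exists an increasing C² diffeomorphism H of [1,r] onto [1,R] (H(1) = 1, H(r) = R, H'(t) > 0 for t ∈ (1,r)) satisfying the Euler–Lagrange equation H''(t) = (b² H(t) − a² t H'(t))/(a² t²) on [1,r] if and only if R ≥ (1 + r^{2/c})/(2 r^{1/c}). -/
open Set

/-- The general solution `A t ^ k + B t ^ (-k)` of the Euler equation. -/
noncomputable def eulerSol (A B k : ℝ) (t : ℝ) : ℝ := A * t ^ k + B * t ^ (-k)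

theorem hasDerivAt_eulerSol (A B k : ℝ) {t : ℝ} (ht : 0 < t) :
    HasDerivAt (eulerSol A B k) (k * eulerSol A (-B) k t / t) t := by
  have h1 := (Real.hasDerivAt_rpow_const (x := t) (p := k) (Or.inl ht.ne')).const_mul A
  have h2 := (Real.hasDerivAt_rpow_const (x := t) (p := -k) (Or.inl ht.ne')).const_mul B
  refine (h1.add h2).congr_deriv ?_
  rw [Real.rpow_sub_one ht.ne', Real.rpow_sub_one ht.ne', eulerSol]
  ring

theorem hasDerivAt_deriv_eulerSol (A B k : ℝ) {t : ℝ} (ht : 0 < t) :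
    HasDerivAt (deriv (eulerSol A B k))
      ((k ^ 2 * eulerSol A B k t - t * deriv (eulerSol A B k) t) / t ^ 2) t := by
  have h := ((hasDerivAt_eulerSol A (-B) k ht).const_mul k).div (hasDerivAt_id t) ht.ne'
  have he : deriv (eulerSol A B k) =ᶠ[nhds t] fun x => k * eulerSol A (-B) k x / x := by
    filter_upwards [lt_mem_nhds ht] with x hx
    exact (hasDerivAt_eulerSol A B k hx).deriv
  refine (h.congr_of_eventuallyEq he).congr_deriv ?_
  rw [(hasDerivAt_eulerSol A B k ht).deriv, neg_neg]
  simp only [id]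
  field_simp

theorem contDiffOn_eulerSol (A B k : ℝ) : ContDiffOn ℝ 2 (eulerSol A B k) (Set.Ioi 0) := by
  intro t ht
  have ht0 : t ≠ 0 := (Set.mem_Ioi.mp ht).ne'
  exact ((contDiffAt_const.mul (Real.contDiffAt_rpow_const_of_ne ht0)).add
    (contDiffAt_const.mul (Real.contDiffAt_rpow_const_of_ne ht0))).contDiffWithinAt

theorem deriv_eulerSol_pos {A B k t : ℝ} (hA : 0 < A) (hBA : B ≤ A) (hk : 0 < k) (ht : 1 < t) :
    0 < deriv (eulerSol A B k) t := by
  have ht0 : 0 < t := by linarith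
  rw [(hasDerivAt_eulerSol A B k ht0).deriv, eulerSol]
  have h1 : 1 < t ^ k := Real.one_lt_rpow ht hk
  have h2 : t ^ (-k) < 1 := Real.rpow_lt_one_of_one_lt_of_neg ht (by linarith)
  have h3 : 0 < t ^ (-k) := Real.rpow_pos_of_pos ht0 _
  have h4 : B * t ^ (-k) ≤ A * t ^ (-k) := by gcongr
  have h5 : A * t ^ (-k) < A * t ^ k := by gcongr; linarith
  have h6 : 0 < A * t ^ k + -B * t ^ (-k) := by linarith
  positivity

/-- A first integral of the equation `t² H'' + t H' = s² H`. -/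
theorem euler_first_integral {H : ℝ → ℝ} {s r : ℝ}
    (hd : ∀ t ∈ Set.Icc 1 r, DifferentiableAt ℝ H t ∧ DifferentiableAt ℝ (deriv H) t)
    (hE : ∀ t ∈ Set.Icc 1 r, deriv (deriv H) t = (s ^ 2 * H t - t * deriv H t) / t ^ 2) :
    ∀ t ∈ Set.Icc 1 r, t ^ (-s) * (t * deriv H t + s * H t) = deriv H 1 + s * H 1 := by
  have key : ∀ t ∈ Set.Icc 1 r,
      HasDerivAt (fun t => t ^ (-s) * (t * deriv H t + s * H t)) 0 t := by
    intro t ht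
    have ht0 : 0 < t := by linarith [ht.1]
    have h1 := Real.hasDerivAt_rpow_const (x := t) (p := -s) (Or.inl ht0.ne')
    have h2 := ((hasDerivAt_id t).mul (hd t ht).2.hasDerivAt).add
      ((hd t ht).1.hasDerivAt.const_mul s)
    refine (h1.mul h2).congr_deriv ?_
    simp only [Pi.add_apply, Pi.mul_apply, id]
    rw [hE t ht, Real.rpow_sub_one ht0.ne']
    field_simp
    ring
  intro t ht
  have h := constant_of_has_deriv_right_zero
    (fun x hx => (key x hx).continuousAt.continuousWithinAt)
    (fun x hx => (key x (Set.Ico_subset_Icc_self hx)).hasDerivWithinAt) t ht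
  simpa using h

/-- For `a, b > 0`, `c = a/b`, `r, R > 1`, an increasing C² diffeomorphism
`H : [1,r] → [1,R]` solving the Euler–Lagrange equation
`H'' = (b² H − a² t H')/(a² t²)` exists if and only if the Nitsche-type condition
`R ≥ (1 + r^{2/c})/(2 r^{1/c})` holds. -/
theorem stmt3 (a b c r R : ℝ) (ha : 0 < a) (hb : 0 < b) (hc : c = a / b)
    (hr : 1 < r) (hR : 1 < R) :
    (∃ H : ℝ → ℝ, H 1 = 1 ∧ H r = R ∧ StrictMonoOn H (Set.Icc 1 r) ∧
      H '' Set.Icc 1 r = Set.Icc 1 R ∧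
      (∀ t ∈ Set.Icc 1 r, DifferentiableAt ℝ H t ∧ DifferentiableAt ℝ (deriv H) t) ∧
      ContDiffOn ℝ 2 H (Set.Icc 1 r) ∧
      (∀ t ∈ Set.Ioo 1 r, 0 < deriv H t) ∧
      (∀ t ∈ Set.Icc 1 r,
        deriv (deriv H) t = (b ^ 2 * H t - a ^ 2 * t * deriv H t) / (a ^ 2 * t ^ 2))) ↔
    R ≥ (1 + r ^ (2 / c)) / (2 * r ^ (1 / c)) := by
  obtain ⟨k, hk⟩ : ∃ k, k = b / a := ⟨_, rfl⟩
  have hk0 : 0 < k := hk ▸ div_pos hb ha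
  have hb' : b = k * a := by rw [hk]; field_simp
  have hr0 : 0 < r := by linarith
  have e1 : 1 / c = k := by rw [hc, hk, one_div_div]
  have e2 : 2 / c = k + k := by rw [← e1]; ring
  have hx1 : 1 < r ^ k := Real.one_lt_rpow hr hk0
  rw [e1, e2, Real.rpow_add hr0]
  have hode : ∀ (t u v : ℝ),
      (b ^ 2 * u - a ^ 2 * t * v) / (a ^ 2 * t ^ 2) = (k ^ 2 * u - t * v) / t ^ 2 := by
    intro t u v
    rw [hb', ← mul_div_mul_left _ (t ^ 2) (pow_ne_zero 2 ha.ne')]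
    ring
  simp only [hode, ge_iff_le]
  rw [div_le_iff₀ (by positivity)]
  have hneg : r ^ (-k) = (r ^ k)⁻¹ := Real.rpow_neg hr0.le k
  constructor
  · rintro ⟨H, H1, Hr, hmono, -, hd, -, -, hE⟩
    have h1 : (1 : ℝ) ∈ Set.Icc 1 r := Set.left_mem_Icc.mpr hr.le
    have h2 : r ∈ Set.Icc 1 r := Set.right_mem_Icc.mpr hr.le
    have hp : 0 ≤ deriv H 1 := by
      rw [← (hd 1 h1).1.derivWithin (uniqueDiffOn_Icc hr 1 h1)]
      exact hmono.monotoneOn.derivWithin_nonneg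
    have i1 := euler_first_integral hd hE r h2
    have i2 := euler_first_integral (s := -k) hd (by simpa using hE) r h2
    rw [H1, Hr] at i1 i2
    rw [neg_neg] at i2
    rw [hneg] at i1
    generalize r ^ k = x at *
    have hx0 : 0 < x := by linarith
    have i3 : r * deriv H r + k * R = x * (deriv H 1 + k * 1) := by
      rw [← i1]; field_simp
    have i4 : k * (R * (2 * x) - (1 + x * x)) = deriv H 1 * (x * x - 1) := by
      linear_combination x * i3 - i2
    have i5 : 0 ≤ k * (R * (2 * x) - (1 + x * x)) := by
      rw [i4]; exact mul_nonneg hp (by nlinarith)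
    linarith [nonneg_of_mul_nonneg_right i5 hk0]
  · intro hRx
    set x := r ^ k with hx
    have hx0 : 0 < x := by linarith
    have hD : 0 < x ^ 2 - 1 := by nlinarith
    set A := (R * x - 1) / (x ^ 2 - 1) with hA
    set B := (x ^ 2 - R * x) / (x ^ 2 - 1) with hB
    have hA0 : 0 < A := div_pos (by nlinarith) hD
    have hBA : B ≤ A := div_le_div_of_nonneg_right (by nlinarith) hD.le
    have H1 : eulerSol A B k 1 = 1 := by
      simp only [eulerSol, Real.one_rpow, hA, hB]
      field_simp
      ring
    have Hr : eulerSol A B k r = R := by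
      simp only [eulerSol, hneg, hA, hB, ← hx]
      field_simp
      ring
    have hpos : ∀ t ∈ Set.Icc 1 r, 0 < t := fun t ht => by linarith [ht.1]
    have hcd : ContDiffOn ℝ 2 (eulerSol A B k) (Set.Icc 1 r) :=
      (contDiffOn_eulerSol A B k).mono hpos
    have hder : ∀ t ∈ Set.Ioo 1 r, 0 < deriv (eulerSol A B k) t :=
      fun t ht => deriv_eulerSol_pos hA0 hBA hk0 ht.1
    have hmono : StrictMonoOn (eulerSol A B k) (Set.Icc 1 r) :=
      strictMonoOn_of_deriv_pos (convex_Icc 1 r) hcd.continuousOn (by rwa [interior_Icc])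
    refine ⟨eulerSol A B k, H1, Hr, hmono, ?_, fun t ht =>
      ⟨(hasDerivAt_eulerSol A B k (hpos t ht)).differentiableAt,
        (hasDerivAt_deriv_eulerSol A B k (hpos t ht)).differentiableAt⟩, hcd, hder,
      fun t ht => (hasDerivAt_deriv_eulerSol A B k (hpos t ht)).deriv⟩
    rw [hcd.continuousOn.image_Icc_of_monotoneOn hr.le hmono.monotoneOn, H1, Hr]
end

section
/- Let c, γ > 0, r > 1, and let H : [1,r] → (0,∞) be a strictly increasing C² solution of (EL). Then exactly one of the following holds: H(t) − c t H'(t) = 0 for all t ∈ [1,r]; H(t) − c t H'(t) > 0 for all t ∈ [1,r]; H(t) − c t H'(t) < 0 for all t ∈ [1,r]. Moreover, in the first case, if H(1) = 1 then H(t) = t^{1/c} for all t ∈ [1,r]. -/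
open Set Filter

noncomputable section

/-- The Euler–Lagrange equation (EL) of the radial total combined energy, with
parameters `c = a/b` and `γ = α/β`:
`H'' = H'² (H − c² t H') (t + γ H H') / (t H (H + c² γ t H'³))`. -/
def SolvesEL (c γ : ℝ) (H : ℝ → ℝ) (s : Set ℝ) : Prop :=
  ∀ t ∈ s, deriv (deriv H) t =
    (deriv H t) ^ 2 * (H t - c ^ 2 * t * deriv H t) * (t + γ * H t * deriv H t) /
      (t * H t * (H t + c ^ 2 * γ * t * (deriv H t) ^ 3))

/-- A solution of `f' = k f` on `[a, b]` is a positive multiple of its initial value. -/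
theorem exists_pos_eq_mul_of_hasDerivAt {a b : ℝ} (hab : a ≤ b) {f k : ℝ → ℝ}
    (hk : ContinuousOn k (Set.Icc a b))
    (hf : ∀ t ∈ Set.Icc a b, HasDerivAt f (k t * f t) t) :
    ∀ t ∈ Set.Icc a b, ∃ e : ℝ, 0 < e ∧ f t = f a * e := by
  set K : ℝ → ℝ := Set.IccExtend hab ((Set.Icc a b).domRestrict k) with hKdef
  have hK : Continuous K := (continuousOn_iff_continuous_domRestrict.1 hk).Icc_extend'
  have hKk : ∀ t ∈ Set.Icc a b, K t = k t := fun t ht => by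
    rw [hKdef, Set.IccExtend_of_mem hab _ ht]; rfl
  have hprim : ∀ t, HasDerivAt (fun x => ∫ s in a..x, K s) (K t) t := fun t =>
    hK.integral_hasStrictDerivAt a t |>.hasDerivAt
  have hconst : ∀ t ∈ Set.Icc a b,
      HasDerivAt (fun x => f x * Real.exp (-∫ s in a..x, K s)) 0 t := fun t ht => by
    refine ((hf t ht).mul (hprim t).neg.exp).congr_deriv ?_
    rw [hKk t ht]
    ring
  intro t ht
  refine ⟨Real.exp (∫ s in a..t, K s), Real.exp_pos _, ?_⟩
  have h := constant_of_has_deriv_right_zero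
    (fun x hx => (hconst x hx).continuousAt.continuousWithinAt)
    (fun x hx => (hconst x (Set.Ico_subset_Icc_self hx)).hasDerivWithinAt) t ht
  simp only [intervalIntegral.integral_same, neg_zero, Real.exp_zero, mul_one] at h
  rw [← h, mul_assoc, ← Real.exp_add, neg_add_cancel, Real.exp_zero, mul_one]

/-- The derivative of a function monotone on `[a, b]` is nonnegative on `[a, b]`. -/
theorem deriv_nonneg_of_monotoneOn_Icc {a b : ℝ} (hab : a < b) {f : ℝ → ℝ}
    (hmono : MonotoneOn f (Set.Icc a b)) {t : ℝ} (ht : t ∈ Set.Icc a b)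
    (hf : DifferentiableAt ℝ f t) : 0 ≤ deriv f t := by
  rw [← hf.derivWithin (uniqueDiffOn_Icc hab t ht)]
  exact hmono.derivWithin_nonneg

/-- Along (EL), `F = H - c t H'` satisfies the linear equation `F' = k F`; this is the algebraic
identity behind it, with `p = H' t` and `h = H t`. -/
theorem deriv_sub_mul_deriv_eq {c γ t h p : ℝ} (ht : t ≠ 0) (hh : h ≠ 0)
    (hD : h + c ^ 2 * γ * t * p ^ 3 ≠ 0) :
    p - (c * p + c * t * (p ^ 2 * (h - c ^ 2 * t * p) * (t + γ * h * p) /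
        (t * h * (h + c ^ 2 * γ * t * p ^ 3)))) =
      p * (h - c * (h + c * t * p) - c * γ * h * p ^ 2) / (h * (h + c ^ 2 * γ * t * p ^ 3)) *
        (h - c * t * p) := by
  generalize hDdef : h + c ^ 2 * γ * t * p ^ 3 = D at hD ⊢
  field_simp
  rw [← hDdef]
  ring

/-- A solution of `H = c t H'` with `H 1 = 1` is the power `t ^ (1 / c)`. -/
theorem eq_rpow_of_sub_mul_deriv_eq_zero {c r : ℝ} (hc : 0 < c) {H : ℝ → ℝ}
    (hdiff : ∀ t ∈ Set.Icc 1 r, DifferentiableAt ℝ H t)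
    (hzero : ∀ t ∈ Set.Icc 1 r, H t - c * t * deriv H t = 0) (h1 : H 1 = 1) :
    ∀ t ∈ Set.Icc 1 r, H t = t ^ (1 / c) := by
  have hconst : ∀ t ∈ Set.Icc 1 r, HasDerivAt (fun x => H x * x ^ (-(1 / c))) 0 t := by
    intro t ht
    have htpos : 0 < t := zero_lt_one.trans_le ht.1
    refine ((hdiff t ht).hasDerivAt.mul
      (Real.hasDerivAt_rpow_const (p := -(1 / c)) (Or.inl htpos.ne'))).congr_deriv ?_
    rw [Real.rpow_sub_one htpos.ne', sub_eq_zero.1 (hzero t ht)]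
    field_simp
    ring
  intro t ht
  have htpos : 0 < t := zero_lt_one.trans_le ht.1
  have h := constant_of_has_deriv_right_zero
    (fun x hx => (hconst x hx).continuousAt.continuousWithinAt)
    (fun x hx => (hconst x (Set.Ico_subset_Icc_self hx)).hasDerivWithinAt) t ht
  rw [h1, Real.one_rpow, one_mul, Real.rpow_neg htpos.le] at h
  exact eq_of_mul_inv_eq_one h

/-- A strictly increasing, positive C² solution `H` of (EL) on `[1,r]`
satisfies exactly one of: `H − c t H' ≡ 0`, `H − c t H' > 0`, or `H − c t H' < 0` on
`[1,r]`; and in the first case, if `H(1) = 1` then `H(t) = t^{1/c}` on `[1,r]`. -/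
theorem stmt10 (c γ r : ℝ) (hc : 0 < c) (hγ : 0 < γ) (hr : 1 < r)
    (H : ℝ → ℝ) (hpos : ∀ t ∈ Set.Icc 1 r, 0 < H t)
    (hmono : StrictMonoOn H (Set.Icc 1 r))
    (hdiff : ∀ t ∈ Set.Icc 1 r, DifferentiableAt ℝ H t ∧ DifferentiableAt ℝ (deriv H) t)
    (hEL : SolvesEL c γ H (Set.Icc 1 r)) :
    ((∀ t ∈ Set.Icc 1 r, H t - c * t * deriv H t = 0) ∧
        ¬ (∀ t ∈ Set.Icc 1 r, 0 < H t - c * t * deriv H t) ∧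
        ¬ (∀ t ∈ Set.Icc 1 r, H t - c * t * deriv H t < 0) ∨
      (∀ t ∈ Set.Icc 1 r, 0 < H t - c * t * deriv H t) ∧
        ¬ (∀ t ∈ Set.Icc 1 r, H t - c * t * deriv H t = 0) ∧
        ¬ (∀ t ∈ Set.Icc 1 r, H t - c * t * deriv H t < 0) ∨
      (∀ t ∈ Set.Icc 1 r, H t - c * t * deriv H t < 0) ∧
        ¬ (∀ t ∈ Set.Icc 1 r, H t - c * t * deriv H t = 0) ∧
        ¬ (∀ t ∈ Set.Icc 1 r, 0 < H t - c * t * deriv H t)) ∧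
    ((∀ t ∈ Set.Icc 1 r, H t - c * t * deriv H t = 0) → H 1 = 1 →
      ∀ t ∈ Set.Icc 1 r, H t = t ^ (1 / c)) := by
  have hp : ∀ t ∈ Set.Icc 1 r, 0 ≤ deriv H t := fun t ht =>
    deriv_nonneg_of_monotoneOn_Icc hr hmono.monotoneOn ht (hdiff t ht).1
  have hD : ∀ t ∈ Set.Icc 1 r, 0 < H t + c ^ 2 * γ * t * deriv H t ^ 3 := fun t ht => by
    have := hp t ht
    have := hpos t ht
    have : 0 < t := zero_lt_one.trans_le ht.1
    positivity
  have hH : ContinuousOn H (Set.Icc 1 r) := fun t ht =>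
    (hdiff t ht).1.continuousAt.continuousWithinAt
  have hH' : ContinuousOn (deriv H) (Set.Icc 1 r) := fun t ht =>
    (hdiff t ht).2.continuousAt.continuousWithinAt
  have hF : ∀ t ∈ Set.Icc 1 r, ∃ e : ℝ, 0 < e ∧
      H t - c * t * deriv H t = (H 1 - c * 1 * deriv H 1) * e := by
    refine exists_pos_eq_mul_of_hasDerivAt (f := fun t => H t - c * t * deriv H t)
      (k := fun t => deriv H t * (H t - c * (H t + c * t * deriv H t) -
        c * γ * H t * deriv H t ^ 2) / (H t * (H t + c ^ 2 * γ * t * deriv H t ^ 3)))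
      hr.le ?_ fun t ht => ?_
    · exact ContinuousOn.div (by fun_prop) (by fun_prop)
        fun t ht => (mul_pos (hpos t ht) (hD t ht)).ne'
    · have htpos : 0 < t := zero_lt_one.trans_le ht.1
      rw [← deriv_sub_mul_deriv_eq htpos.ne' (hpos t ht).ne' (hD t ht).ne', ← hEL t ht]
      refine ((hdiff t ht).1.hasDerivAt.sub
        (((hasDerivAt_id t).const_mul c).mul (hdiff t ht).2.hasDerivAt)).congr_deriv ?_
      simp
  have h1 : (1 : ℝ) ∈ Set.Icc 1 r := ⟨le_rfl, hr.le⟩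
  refine ⟨?_, eq_rpow_of_sub_mul_deriv_eq_zero hc fun t ht => (hdiff t ht).1⟩
  rcases lt_trichotomy (H 1 - c * 1 * deriv H 1) 0 with h | h | h
  · exact Or.inr (Or.inr ⟨fun t ht => by
      obtain ⟨e, he, hte⟩ := hF t ht
      exact hte ▸ mul_neg_of_neg_of_pos h he,
      fun h0 => h.ne (h0 1 h1), fun h0 => h.not_gt (h0 1 h1)⟩)
  · exact Or.inl ⟨fun t ht => by
      obtain ⟨e, -, hte⟩ := hF t ht
      rw [hte, h, zero_mul],
      fun h0 => (h0 1 h1).ne' h, fun h0 => (h0 1 h1).ne h⟩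
  · exact Or.inr (Or.inl ⟨fun t ht => by
      obtain ⟨e, he, hte⟩ := hF t ht
      exact hte ▸ mul_pos h he,
      fun h0 => h.ne' (h0 1 h1), fun h0 => h.not_gt (h0 1 h1)⟩)

end
end

section
/- Let 0 < c < 1, γ > 0, and 1 < q < 1/c. Let Φ be a solution of the ODE (B) on its maximal interval of existence I ⊆ (0,∞) with 1 ∈ I and Φ(1) = q. Then [1,∞) ⊆ I, Φ is strictly increasing on [1,∞), q ≤ Φ(s) < 1/c for all s ≥ 1, and lim_{s→∞} Φ(s) = 1/c; in particular Φ is an increasing diffeomorphism of [1,∞) onto [q, 1/c). -/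
open Set Filter

noncomputable section

/-- The auxiliary first order ODE (B):
`Φ'(s) = − Φ(c²Φ² − 1)(1 + γ s² Φ²) / ( s (Φ − 1)(1 + c² γ s² Φ³) )`. -/
def SolvesB (c γ : ℝ) (Φ : ℝ → ℝ) (I : Set ℝ) : Prop :=
  ∀ s ∈ I, HasDerivAt Φ
    (-(Φ s * (c ^ 2 * Φ s ^ 2 - 1) * (1 + γ * s ^ 2 * Φ s ^ 2)) /
      (s * (Φ s - 1) * (1 + c ^ 2 * γ * s ^ 2 * Φ s ^ 3))) s

/-- `Φ` is a solution of (B) on its maximal interval of existence `I ⊆ (0,∞)`: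
`I` is an open subinterval of `(0,∞)` on which `Φ` solves (B), and no solution of (B)
on a larger open subinterval of `(0,∞)` agrees with `Φ` on `I`. -/
def IsMaximalBSolution (c γ : ℝ) (Φ : ℝ → ℝ) (I : Set ℝ) : Prop :=
  IsOpen I ∧ I.OrdConnected ∧ I ⊆ Set.Ioi 0 ∧ SolvesB c γ Φ I ∧
    ∀ (Ψ : ℝ → ℝ) (J : Set ℝ), IsOpen J → J.OrdConnected → J ⊆ Set.Ioi 0 →
      SolvesB c γ Ψ J → I ⊆ J → Set.EqOn Ψ Φ I → J = I

open Topology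

/-- A solution of a scalar nonautonomous ODE exists locally where the right-hand side is `C¹`. -/
theorem exists_hasDerivAt_of_contDiffAt_uncurry {f : ℝ × ℝ → ℝ} {b L : ℝ}
    (hf : ContDiffAt ℝ 1 f (b, L)) :
    ∃ ψ : ℝ → ℝ, ψ b = L ∧ ∃ ε > 0, ∀ t ∈ Ioo (b - ε) (b + ε),
      HasDerivAt ψ (f (t, ψ t)) t := by
  have hF : ContDiffAt ℝ 1 (fun p : ℝ × ℝ => ((1 : ℝ), f p)) (b, L) :=
    contDiffAt_const.prodMk hf
  obtain ⟨α, hα, ε, hε, hd⟩ :=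
    hF.exists_forall_mem_closedBall_exists_eq_forall_mem_Ioo_hasDerivAt₀ b
  have hd₁ : ∀ t ∈ Ioo (b - ε) (b + ε), HasDerivAt (fun t => (α t).1) 1 t := fun t ht => 
    (ContinuousLinearMap.fst ℝ ℝ ℝ).hasFDerivAt.comp_hasDerivAt t (hd t ht)
  have hd₂ : ∀ t ∈ Ioo (b - ε) (b + ε), HasDerivAt (fun t => (α t).2) (f (α t)) t :=
    fun t ht => (ContinuousLinearMap.snd ℝ ℝ ℝ).hasFDerivAt.comp_hasDerivAt t (hd t ht)
  have hfst : ∀ t ∈ Ioo (b - ε) (b + ε), (α t).1 = t := fun t ht => by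
    have hd₀ : ∀ t ∈ Ioo (b - ε) (b + ε), HasDerivAt (fun t => (α t).1 - t) 0 t :=
      fun t ht => ((hd₁ t ht).sub (hasDerivAt_id t)).congr_deriv (sub_self 1)
    have := isOpen_Ioo.is_const_of_deriv_eq_zero isPreconnected_Ioo
      (fun t ht => (hd₀ t ht).differentiableAt.differentiableWithinAt)
      (fun t ht => (hd₀ t ht).deriv) ht (show b ∈ Ioo (b - ε) (b + ε) by constructor <;> linarith)
    simp only [hα, sub_self] at this
    linarith
  refine ⟨fun t => (α t).2, by simp [hα], ε, hε, fun t ht => ?_⟩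
  have h : α t = (t, (α t).2) := Prod.ext (hfst t ht) rfl
  simpa only [← h] using hd₂ t ht

/-- Two solutions of an ODE that share a limit value at `b` glue to a solution across `b`. -/
theorem hasDerivAt_ite_of_tendsto {f : ℝ × ℝ → ℝ} {φ ψ : ℝ → ℝ} {a b d L : ℝ} (hab : a < b)
    (hbd : b < d) (hf : ContinuousAt f (b, L))
    (hφ : ∀ t ∈ Ioo a b, HasDerivAt φ (f (t, φ t)) t) (hlim : Tendsto φ (𝓝[<] b) (𝓝 L))
    (hψb : ψ b = L) (hψ : ∀ t ∈ Ico b d, HasDerivAt ψ (f (t, ψ t)) t) :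
    ∀ t ∈ Ioo a d, HasDerivAt (fun s => if s < b then φ s else ψ s)
      (f (t, if t < b then φ t else ψ t)) t := by
  intro t ht
  rcases lt_trichotomy t b with h | rfl | h
  · rw [if_pos h]
    exact (hφ t ⟨ht.1, h⟩).congr_of_eventuallyEq <|
      (eventually_lt_nhds h).mono fun s hs => if_pos hs
  · have hIoo : Ioo a t ∈ 𝓝[<] t := Ioo_mem_nhdsLT hab
    rw [if_neg (lt_irrefl t), hψb]
    set g : ℝ → ℝ := fun s => if s < t then φ s else ψ s with hg
    have hgt : g t = L := by simp [hg, hψb]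
    have hgd : ∀ s ∈ Ioo a t, HasDerivAt g (f (s, φ s)) s := fun s hs =>
      (hφ s hs).congr_of_eventuallyEq <|
        (eventually_lt_nhds hs.2).mono fun r hr => if_pos hr
    have hleft : HasDerivWithinAt g (f (t, L)) (Iic t) t := by
      refine hasDerivWithinAt_Iic_of_tendsto_deriv (s := Ioo a t)
        (fun s hs => (hgd s hs).differentiableAt.differentiableWithinAt) ?_ hIoo ?_
      · rw [ContinuousWithinAt, hgt]
        refine ((hlim.congr' ?_).mono_left (nhdsWithin_mono t Ioo_subset_Iio_self))
        filter_upwards [self_mem_nhdsWithin] with s hs using (if_pos hs).symm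
      · have : Tendsto (fun s => f (s, φ s)) (𝓝[<] t) (𝓝 (f (t, L))) :=
          hf.tendsto.comp ((tendsto_nhdsWithin_of_tendsto_nhds tendsto_id).prodMk_nhds hlim)
        refine this.congr' ?_
        filter_upwards [hIoo] with s hs using (hgd s hs).deriv.symm
    have hright : HasDerivWithinAt g (f (t, L)) (Ici t) t := by
      have := (hψ t ⟨le_rfl, hbd⟩).hasDerivWithinAt (s := Ici t)
      rw [hψb] at this
      exact this.congr (fun s hs => if_neg (not_lt.2 hs)) (if_neg (lt_irrefl t))
    have := hleft.union hright
    rwa [Iic_union_Ici, hasDerivWithinAt_univ] at this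
  · rw [if_neg h.not_gt]
    exact (hψ t ⟨h.le, ht.2⟩).congr_of_eventuallyEq <|
      (eventually_gt_nhds h).mono fun s hs => if_neg (not_lt.2 hs.le)

/-- A function with positive derivative at `x` is larger than its value at `x` just to the right
of `x`. -/
theorem HasDerivAt.eventually_nhdsGT_lt {g : ℝ → ℝ} {g' x : ℝ} (hg : HasDerivAt g g' x)
    (hpos : 0 < g') : ∀ᶠ y in 𝓝[>] x, g x < g y := by
  have h := (hg.tendsto_slope.mono_left
    (nhdsWithin_mono x fun y hy => ne_of_gt hy)).eventually_const_lt hpos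
  filter_upwards [h, self_mem_nhdsWithin] with y hy hxy
  exact (slope_pos_iff_of_le (le_of_lt hxy)).1 hy

/-- The right-hand side of (B). -/
def rhsB (c γ : ℝ) (p : ℝ × ℝ) : ℝ :=
  -(p.2 * (c ^ 2 * p.2 ^ 2 - 1) * (1 + γ * p.1 ^ 2 * p.2 ^ 2)) /
    (p.1 * (p.2 - 1) * (1 + c ^ 2 * γ * p.1 ^ 2 * p.2 ^ 3))

theorem contDiffAt_rhsB {c γ s y : ℝ} (hγ : 0 < γ) (hs : 0 < s) (hy : 1 < y) :
    ContDiffAt ℝ 1 (rhsB c γ) (s, y) := by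
  unfold rhsB
  refine ContDiffAt.div (by fun_prop) (by fun_prop) ?_
  have : 0 < y - 1 := by linarith
  have : 0 < y := by linarith
  positivity

theorem rhsB_eq {c γ s y : ℝ} :
    rhsB c γ (s, y) = (1 - c * y) * (y * (1 + c * y) / (y - 1)) *
      ((1 + γ * s ^ 2 * y ^ 2) / (1 + c ^ 2 * γ * s ^ 2 * y ^ 3)) / s := by
  simp only [rhsB, div_eq_mul_inv, mul_inv]
  ring

theorem le_rhsB {c γ s y : ℝ} (hc0 : 0 < c) (hc1 : c < 1) (hγ : 0 < γ) (hs : 0 < s)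
    (hy : 1 < y) (hcy : c * y < 1) : (1 - c * y) / s ≤ rhsB c γ (s, y) := by
  rw [rhsB_eq]
  have hy1 : 0 < y - 1 := by linarith
  have hy0 : 0 < y := by linarith
  have hu : 0 < 1 - c * y := by linarith
  have h1 : 1 ≤ y * (1 + c * y) / (y - 1) := by
    rw [one_le_div hy1]
    nlinarith [mul_pos hy0 (mul_pos hc0 hy0)]
  have h2 : 1 ≤ (1 + γ * s ^ 2 * y ^ 2) / (1 + c ^ 2 * γ * s ^ 2 * y ^ 3) := by
    rw [one_le_div (by positivity)]
    have : c * (c * y) ≤ 1 := by nlinarith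
    have : 0 ≤ γ * s ^ 2 * y ^ 2 * (1 - c * (c * y)) :=
      mul_nonneg (by positivity) (by linarith)
    nlinarith
  gcongr
  calc 1 - c * y = (1 - c * y) * 1 * 1 := by ring
    _ ≤ _ := by gcongr

theorem rhsB_le {c γ q s y : ℝ} (hc0 : 0 < c) (hc1 : c < 1) (hγ : 0 < γ) (hq : 1 < q)
    (hs : 1 ≤ s) (hqy : q ≤ y) (hcy : c * y < 1) :
    rhsB c γ (s, y) ≤ (1 - c * y) * (2 / (c ^ 3 * (q - 1))) := by
  rw [rhsB_eq]
  have hq1 : 0 < q - 1 := by linarith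
  have hy1 : 0 < y - 1 := by linarith
  have hy0 : 0 < y := by linarith
  have hu : 0 < 1 - c * y := by linarith
  have hs0 : 0 < s := by linarith
  have h1 : y * (1 + c * y) / (y - 1) ≤ (1 / c * 2) / (q - 1) := by
    have : y ≤ 1 / c := by rw [le_div_iff₀ hc0]; linarith
    gcongr
    linarith
  have h2 : (1 + γ * s ^ 2 * y ^ 2) / (1 + c ^ 2 * γ * s ^ 2 * y ^ 3) ≤ 1 / c ^ 2 := by
    rw [div_le_div_iff₀ (by positivity) (by positivity)]
    have : c ^ 2 ≤ 1 := by nlinarith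
    have : 0 ≤ c ^ 2 * (γ * s ^ 2 * y ^ 2) * (y - 1) := by positivity
    nlinarith
  calc _ ≤ (1 - c * y) * (y * (1 + c * y) / (y - 1)) *
        ((1 + γ * s ^ 2 * y ^ 2) / (1 + c ^ 2 * γ * s ^ 2 * y ^ 3)) :=
        div_le_self (by positivity) hs
    _ ≤ (1 - c * y) * ((1 / c * 2) / (q - 1)) * (1 / c ^ 2) := by gcongr
    _ = _ := by field_simp

/-- Solutions of (B) starting in `[q, 1/c)` stay there. -/
theorem mem_Ico_of_hasDerivAt_rhsB {c γ q T : ℝ} (hc0 : 0 < c) (hc1 : c < 1) (hγ : 0 < γ)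
    (hq0 : 1 < q) (hq1 : q < 1 / c) {Φ : ℝ → ℝ} (hΦ1 : Φ 1 = q)
    (hΦ : ∀ s ∈ Icc 1 T, HasDerivAt Φ (rhsB c γ (s, Φ s)) s) :
    ∀ s ∈ Icc 1 T, q ≤ Φ s ∧ c * Φ s < 1 := by
  have hcq : c * q < 1 := by rw [lt_div_iff₀ hc0] at hq1; linarith
  set K : ℝ := c * (2 / (c ^ 3 * (q - 1))) + 1 with hK
  set g : ℝ → ℝ := fun s => (1 - c * Φ s) * Real.exp (K * s) with hg
  set S : Set ℝ := {s | q ≤ Φ s ∧ g 1 ≤ g s} with hS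
  have hg1 : 0 < g 1 := mul_pos (by rw [hΦ1]; linarith) (Real.exp_pos _)
  have hSlt : ∀ s ∈ S, c * Φ s < 1 := fun s hs => by
    have := pos_of_mul_pos_left (hg1.trans_le hs.2) (Real.exp_pos _).le
    linarith
  have hΦc : ContinuousOn Φ (Icc 1 T) := fun s hs => (hΦ s hs).continuousAt.continuousWithinAt
  have hgc : ContinuousOn g (Icc 1 T) := by fun_prop
  have hsub : Icc 1 T ⊆ S := by
    refine IsClosed.Icc_subset_of_forall_mem_nhdsWithin ?_ ⟨hΦ1.ge, le_rfl⟩ ?_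
    · have := (hΦc.preimage_isClosed_of_isClosed isClosed_Icc (isClosed_Ici (a := q))).inter
        (hgc.preimage_isClosed_of_isClosed isClosed_Icc (isClosed_Ici (a := g 1)))
      convert this using 1
      ext s
      simp only [hS, mem_inter_iff, mem_ofPred_eq, mem_preimage, mem_Ici]
      tauto
    · rintro x ⟨hxS, hx⟩
      have hx0 : 0 < x := by linarith [hx.1]
      have hcx := hSlt x hxS
      have hd := hΦ x (Ico_subset_Icc_self hx)
      have hpos : 0 < rhsB c γ (x, Φ x) :=
        (div_pos (by linarith) hx0).trans_le
          (le_rhsB hc0 hc1 hγ hx0 (hq0.trans_le hxS.1) hcx)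
      have hup := rhsB_le hc0 hc1 hγ hq0 hx.1 hxS.1 hcx
      have hdg : HasDerivAt g (-(c * rhsB c γ (x, Φ x)) * Real.exp (K * x) +
          (1 - c * Φ x) * (Real.exp (K * x) * (K * 1))) x :=
        ((hd.const_mul c).const_sub 1).mul ((hasDerivAt_id x).const_mul K).exp
      have hdgpos : 0 < -(c * rhsB c γ (x, Φ x)) * Real.exp (K * x) +
          (1 - c * Φ x) * (Real.exp (K * x) * (K * 1)) := by
        have : 0 < (1 - c * Φ x) * K - c * rhsB c γ (x, Φ x) := by
          have := mul_le_mul_of_nonneg_left hup hc0.le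
          rw [hK]
          nlinarith
        have := mul_pos this (Real.exp_pos (K * x))
        linarith
      filter_upwards [hd.eventually_nhdsGT_lt hpos, hdg.eventually_nhdsGT_lt hdgpos] with y h1 h2
      exact ⟨hxS.1.trans h1.le, hxS.2.trans h2.le⟩
  exact fun s hs => ⟨(hsub hs).1, hSlt s (hsub hs)⟩

/-- For `0 < c < 1`, `γ > 0`, `1 < q < 1/c`, a maximal solution `Φ` of
(B) with `Φ(1) = q` contains `[1,∞)` in its maximal interval, is strictly increasing on
`[1,∞)` with `q ≤ Φ(s) < 1/c` for `s ≥ 1`, tends to `1/c` at `∞`, and is an increasing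
diffeomorphism of `[1,∞)` onto `[q, 1/c)`. -/
theorem stmt12 (c γ q : ℝ) (hc0 : 0 < c) (hc1 : c < 1) (hγ : 0 < γ)
    (hq0 : 1 < q) (hq1 : q < 1 / c)
    (Φ : ℝ → ℝ) (I : Set ℝ) (hmax : IsMaximalBSolution c γ Φ I)
    (h1 : (1 : ℝ) ∈ I) (hΦ1 : Φ 1 = q) :
    Set.Ici (1 : ℝ) ⊆ I ∧ StrictMonoOn Φ (Set.Ici 1) ∧
      (∀ s : ℝ, 1 ≤ s → q ≤ Φ s ∧ Φ s < 1 / c) ∧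
      Filter.Tendsto Φ Filter.atTop (nhds (1 / c)) ∧
      Φ '' Set.Ici 1 = Set.Ico q (1 / c) := by
  obtain ⟨hIo, hIc, hI0, hsol, hext⟩ := hmax
  have hd : ∀ s ∈ I, HasDerivAt Φ (rhsB c γ (s, Φ s)) s := hsol
  have hbd : ∀ s ∈ I, 1 ≤ s → q ≤ Φ s ∧ c * Φ s < 1 := fun s hs h1s =>
    mem_Ico_of_hasDerivAt_rhsB hc0 hc1 hγ hq0 hq1 hΦ1
      (fun t ht => hd t (hIc.out h1 hs ht)) s ⟨h1s, le_rfl⟩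
  have hlow : ∀ s ∈ I, 1 ≤ s → (1 - c * Φ s) / s ≤ rhsB c γ (s, Φ s) := fun s hs h1s =>
    le_rhsB hc0 hc1 hγ (hI0 hs) (hq0.trans_le (hbd s hs h1s).1) (hbd s hs h1s).2
  have hpos : ∀ s ∈ I, 1 ≤ s → 0 < rhsB c γ (s, Φ s) := fun s hs h1s =>
    (div_pos (by linarith [(hbd s hs h1s).2]) (hI0 hs)).trans_le (hlow s hs h1s)
  have hmono : ∀ D : Set ℝ, Convex ℝ D → D ⊆ I → D ⊆ Ici 1 → StrictMonoOn Φ D :=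
    fun D hD hDI hD1 => strictMonoOn_of_deriv_pos hD
      (fun s hs => (hd s (hDI hs)).continuousAt.continuousWithinAt) fun s hs => by
        rw [(hd s (hDI (interior_subset hs))).deriv]
        exact hpos s (hDI (interior_subset hs)) (hD1 (interior_subset hs))
  have hsub : Ici (1 : ℝ) ⊆ I := by
    intro T hT
    by_contra hTI
    have hub : ∀ s ∈ I, s < T := fun s hs => by
      by_contra! h
      exact hTI (hIc.out h1 hs ⟨hT, h⟩)
    have hbdd : BddAbove I := ⟨T, fun s hs => (hub s hs).le⟩
    set b := sSup I with hb
    have hbI : b ∉ I := fun h => by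
      obtain ⟨s, hs, hsI⟩ := Filter.nonempty_of_mem
        (inter_mem (mem_nhdsWithin_of_mem_nhds (hIo.mem_nhds h))
          (self_mem_nhdsWithin : Ioi b ∈ 𝓝[>] b))
      exact absurd (le_csSup hbdd hs) (not_le.2 hsI)
    have hlt : ∀ s ∈ I, s < b := fun s hs =>
      (le_csSup hbdd hs).lt_of_ne fun h => hbI (by rwa [hb, ← h])
    have h1b : 1 < b := hlt 1 h1
    have hIoo : Ioo 1 b ⊆ I := fun s hs => by
      obtain ⟨t, ht, hst⟩ := exists_lt_of_lt_csSup ⟨1, h1⟩ hs.2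
      exact hIc.out h1 ht ⟨hs.1.le, hst.le⟩
    have hmono' := (hmono _ (convex_Ioo 1 b) hIoo fun s hs => hs.1.le).monotoneOn
    have hlim := hmono'.tendsto_nhdsWithin_Ioo_left (nonempty_Ioo.2 h1b) ⟨1 / c, by
      rintro _ ⟨s, hs, rfl⟩
      rw [le_div_iff₀ hc0]
      linarith [(hbd s (hIoo hs) hs.1.le).2]⟩
    set L := sSup (Φ '' Ioo 1 b)
    have hL : 1 < L := hq0.trans_le <| ge_of_tendsto hlim <| by
      filter_upwards [Ioo_mem_nhdsLT h1b] with s hs using (hbd s (hIoo hs) hs.1.le).1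
    have hf := contDiffAt_rhsB (c := c) hγ (by linarith : 0 < b) hL
    obtain ⟨ψ, hψb, ε, hε, hψ⟩ := exists_hasDerivAt_of_contDiffAt_uncurry hf
    have hglue := hasDerivAt_ite_of_tendsto h1b (by linarith : b < b + ε) hf.continuousAt
      (fun t ht => hd t (hIoo ht)) hlim hψb
      fun t ht => hψ t ⟨by linarith [ht.1], ht.2⟩
    have hJ := hext (fun s => if s < b then Φ s else ψ s) (I ∪ Ioo 1 (b + ε))
      (hIo.union isOpen_Ioo) ?_ ?_ ?_ subset_union_left fun s hs => if_pos (hlt s hs)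
    · exact hbI (hJ ▸ Or.inr ⟨h1b, by linarith⟩)
    · rw [← isPreconnected_iff_ordConnected]
      have hmem : (1 + b) / 2 ∈ Ioo 1 b := ⟨by linarith, by linarith⟩
      exact IsPreconnected.union _ (hIoo hmem) ⟨hmem.1, hmem.2.trans (by linarith)⟩
        (isPreconnected_iff_ordConnected.2 hIc) isPreconnected_Ioo
    · exact union_subset hI0 fun s hs => zero_lt_one.trans hs.1
    · rintro s (hs | hs)
      · have h := (hd s hs).congr_of_eventuallyEq
          ((eventually_lt_nhds (hlt s hs)).mono fun t ht =>
            (if_pos ht : (if t < b then Φ t else ψ t) = Φ t))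
        simp only [if_pos (hlt s hs)]
        exact h
      · exact hglue s hs
  have hlt : ∀ s : ℝ, 1 ≤ s → Φ s < 1 / c := fun s hs => by
    rw [lt_div_iff₀ hc0]
    linarith [(hbd s (hsub hs) hs).2]
  have hcont : ContinuousOn Φ (Ici 1) := fun s hs =>
    (hd s (hsub hs)).continuousAt.continuousWithinAt
  have hdecay : AntitoneOn (fun s => (1 - c * Φ s) * s ^ c) (Ici 1) := by
    have hdg : ∀ s ∈ Ici (1 : ℝ), HasDerivAt (fun s => (1 - c * Φ s) * s ^ c)
        (-(c * rhsB c γ (s, Φ s)) * s ^ c + (1 - c * Φ s) * (c * s ^ (c - 1))) s :=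
      fun s hs => (((hd s (hsub hs)).const_mul c).const_sub 1).mul
        (Real.hasDerivAt_rpow_const (Or.inl (hI0 (hsub hs)).ne'))
    refine antitoneOn_of_deriv_nonpos (convex_Ici 1)
      (fun s hs => (hdg s hs).continuousAt.continuousWithinAt)
      (fun s hs => (hdg s (interior_subset hs)).differentiableAt.differentiableWithinAt)
      fun s hs => ?_
    have hs1 := interior_subset hs
    have hs0 : 0 < s := hI0 (hsub hs1)
    rw [(hdg s hs1).deriv, Real.rpow_sub_one hs0.ne']
    have := mul_le_mul_of_nonneg_left (hlow s (hsub hs1) hs1)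
      (mul_pos hc0 (Real.rpow_pos_of_pos hs0 c)).le
    have e : (1 - c * Φ s) * (c * (s ^ c / s)) = c * s ^ c * ((1 - c * Φ s) / s) := by ring
    rw [e]
    linarith
  have htend : Tendsto Φ atTop (𝓝 (1 / c)) := by
    have hz : Tendsto (fun s : ℝ => 1 / c - (1 - c * q) / c * s ^ (-c)) atTop (𝓝 (1 / c)) := by
      simpa using ((tendsto_rpow_neg_atTop hc0).const_mul ((1 - c * q) / c)).const_sub (1 / c)
    refine tendsto_of_tendsto_of_tendsto_of_le_of_le' hz tendsto_const_nhds ?_ ?_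
    · filter_upwards [eventually_ge_atTop 1] with s hs
      have h := hdecay self_mem_Ici hs hs
      have hs0 : 0 < s := by linarith
      have hsc : 0 < s ^ c := Real.rpow_pos_of_pos hs0 c
      simp only [hΦ1, Real.one_rpow, mul_one] at h
      rw [← le_div_iff₀ hsc] at h
      have e : 1 / c - (1 - c * q) / c * s ^ (-c) = (1 - (1 - c * q) / s ^ c) / c := by
        rw [Real.rpow_neg hs0.le]
        ring
      rw [e, div_le_iff₀ hc0]
      linarith
    · filter_upwards [eventually_ge_atTop 1] with s hs using (hlt s hs).le
  refine ⟨hsub, hmono _ (convex_Ici 1) hsub subset_rfl,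
    fun s hs => ⟨(hbd s (hsub hs) hs).1, hlt s hs⟩, htend, Subset.antisymm ?_ ?_⟩
  · rintro _ ⟨s, hs, rfl⟩
    exact ⟨(hbd s (hsub hs) hs).1, hlt s hs⟩
  · rintro y ⟨hqy, hyc⟩
    obtain ⟨s, hys, hs⟩ := ((htend.eventually_const_lt hyc).and (eventually_ge_atTop 1)).exists
    obtain ⟨t, ht, rfl⟩ := intermediate_value_Icc hs (hcont.mono Icc_subset_Ici_self)
      ⟨hΦ1.trans_le hqy, hys.le⟩
    exact ⟨t, ht.1, rfl⟩

end
end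

section
/- Let 0 < c < 1, γ > 0, and q > 1/c. Let Φ be a solution of the ODE (B) on its maximal interval of existence I ⊆ (0,∞) with 1 ∈ I and Φ(1) = q. Then I = (0,∞), Φ is strictly decreasing, Φ(s) > 1/c for all s > 0, lim_{s→∞} Φ(s) = 1/c, and lim_{s→0+} Φ(s) = +∞; in particular Φ is a decreasing diffeomorphism of (0,∞) onto (1/c, +∞). -/
open Set Filter

noncomputable section

/-- The right-hand side of (B), as a function of `(s, Φ)`. -/
def fieldB (c γ : ℝ) (p : ℝ × ℝ) : ℝ :=
  -(p.2 * (c ^ 2 * p.2 ^ 2 - 1) * (1 + γ * p.1 ^ 2 * p.2 ^ 2)) /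
    (p.1 * (p.2 - 1) * (1 + c ^ 2 * γ * p.1 ^ 2 * p.2 ^ 3))

/-- The logarithmic decay rate of `c Φ - 1` with respect to `log s` along solutions of (B). -/
def rateB (c γ s y : ℝ) : ℝ :=
  c * y * (c * y + 1) * (1 + γ * s ^ 2 * y ^ 2) / ((y - 1) * (1 + c ^ 2 * γ * s ^ 2 * y ^ 3))

section Continuation

variable {F : ℝ × ℝ → ℝ} {Φ : ℝ → ℝ} {I : Set ℝ} {a b L : ℝ}

lemma exists_local_solution (hF : ContDiffAt ℝ 1 F (b, L)) :
    ∃ ψ : ℝ → ℝ, ψ b = L ∧ ∃ ε > 0, ∀ t ∈ Ioo (b - ε) (b + ε), HasDerivAt ψ (F (t, ψ t)) t := by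
  have hG : ContDiffAt ℝ 1 (fun p : ℝ × ℝ => ((1 : ℝ), F p)) (b, L) := contDiffAt_const.prodMk hF
  obtain ⟨α, hα, ε, hε, hd⟩ :=
    hG.exists_forall_mem_closedBall_exists_eq_forall_mem_Ioo_hasDerivAt₀ b
  have hb : b ∈ Ioo (b - ε) (b + ε) := by constructor <;> linarith
  have hd1 : ∀ t ∈ Ioo (b - ε) (b + ε), HasDerivAt (fun t => (α t).1) 1 t := fun t ht =>
    ((hasFDerivAt_fst (𝕜 := ℝ) (p := α t)).comp_hasDerivAt t (hd t ht))
  have hd2 : ∀ t ∈ Ioo (b - ε) (b + ε), HasDerivAt (fun t => (α t).2) (F (α t)) t := fun t ht =>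
    ((hasFDerivAt_snd (𝕜 := ℝ) (p := α t)).comp_hasDerivAt t (hd t ht))
  have hfst : ∀ t ∈ Ioo (b - ε) (b + ε), (α t).1 = t := by
    have hdiff : ∀ t ∈ Ioo (b - ε) (b + ε), HasDerivAt (fun t => (α t).1 - t) 0 t := fun t ht => by
      exact ((hd1 t ht).sub (hasDerivAt_id t)).congr_deriv (sub_self 1)
    intro t ht
    have := isOpen_Ioo.is_const_of_deriv_eq_zero isPreconnected_Ioo
      (fun x hx => (hdiff x hx).differentiableAt.differentiableWithinAt)
      (fun x hx => (hdiff x hx).deriv) ht hb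
    simp only [hα] at this
    linarith
  refine ⟨fun t => (α t).2, by simp [hα], ε, hε, fun t ht => ?_⟩
  have : (t, (α t).2) = α t := Prod.ext (hfst t ht).symm rfl
  simpa only [this] using hd2 t ht

lemma exists_extension_right (hF : ContDiffAt ℝ 1 F (b, L)) (hab : a < b) (hI : IsOpen I)
    (hIb : I ⊆ Iio b) (habI : Ioo a b ⊆ I) (hΦ : ∀ s ∈ I, HasDerivAt Φ (F (s, Φ s)) s)
    (hlim : Tendsto Φ (nhdsWithin b (Iio b)) (nhds L)) :
    ∃ ε > 0, ∃ Ψ : ℝ → ℝ, EqOn Ψ Φ I ∧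
      ∀ s ∈ I ∪ Ioo a (b + ε), HasDerivAt Ψ (F (s, Ψ s)) s := by
  obtain ⟨ψ, hψb, ε, hε, hψ⟩ := exists_local_solution hF
  set Ψ : ℝ → ℝ := fun s => if s < b then Φ s else ψ s with hΨ
  have hlt : ∀ s < b, Ψ s = Φ s := fun s hs => if_pos hs
  have hge : ∀ s, b ≤ s → Ψ s = ψ s := fun s hs => if_neg hs.not_gt
  have hΨb : Ψ b = L := (hge b le_rfl).trans hψb
  have hleft : ∀ s ∈ I, HasDerivAt Ψ (F (s, Ψ s)) s := fun s hs => by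
    rw [hlt s (hIb hs)]
    refine (hΦ s hs).congr_of_eventuallyEq ?_
    filter_upwards [hI.mem_nhds hs] with x hx using hlt x (hIb hx)
  have hIoo : Ioo a b ∈ nhdsWithin b (Iio b) := Ioo_mem_nhdsLT hab
  have hΨlim : Tendsto Ψ (nhdsWithin b (Iio b)) (nhds L) :=
    hlim.congr' (by filter_upwards [self_mem_nhdsWithin] with x hx using (hlt x hx).symm)
  have hat : HasDerivAt Ψ (F (b, Ψ b)) b := by
    have h₁ : HasDerivWithinAt Ψ (F (b, Ψ b)) (Iic b) b := by
      refine hasDerivWithinAt_Iic_of_tendsto_deriv (s := Ioo a b)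
        (fun x hx => (hleft x (habI hx)).differentiableAt.differentiableWithinAt) ?_ hIoo ?_
      · rw [ContinuousWithinAt, hΨb]
        exact hΨlim.mono_left (nhdsWithin_mono _ Ioo_subset_Iio_self)
      · have : Tendsto (fun x => F (x, Ψ x)) (nhdsWithin b (Iio b)) (nhds (F (b, L))) :=
          hF.continuousAt.tendsto.comp
            ((tendsto_id.mono_left nhdsWithin_le_nhds).prodMk_nhds hΨlim)
        rw [hΨb]
        refine this.congr' ?_
        filter_upwards [hIoo] with x hx using (hleft x (habI hx)).deriv.symm
    have h₂ : HasDerivWithinAt Ψ (F (b, Ψ b)) (Ici b) b := by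
      rw [hge b le_rfl]
      exact (hψ b ⟨by linarith, by linarith⟩).hasDerivWithinAt.congr (fun x hx => hge x hx)
        (hge b le_rfl)
    have := h₁.union h₂
    rw [Iic_union_Ici] at this
    exact hasDerivWithinAt_univ.mp this
  refine ⟨ε, hε, Ψ, fun s hs => hlt s (hIb hs), ?_⟩
  rintro s (hs | hs)
  · exact hleft s hs
  · rcases lt_trichotomy s b with h | h | h
    · exact hleft s (habI ⟨hs.1, h⟩)
    · exact h ▸ hat
    · rw [hge s h.le]
      refine (hψ s ⟨by linarith, hs.2⟩).congr_of_eventuallyEq ?_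
      filter_upwards [Ioi_mem_nhds h] with x hx using hge x (le_of_lt hx)

lemma exists_extension_left (hF : ContDiffAt ℝ 1 F (a, L)) (hab : a < b) (hI : IsOpen I)
    (hIa : I ⊆ Ioi a) (habI : Ioo a b ⊆ I) (hΦ : ∀ s ∈ I, HasDerivAt Φ (F (s, Φ s)) s)
    (hlim : Tendsto Φ (nhdsWithin a (Ioi a)) (nhds L)) :
    ∃ ε > 0, ∃ Ψ : ℝ → ℝ, EqOn Ψ Φ I ∧
      ∀ s ∈ I ∪ Ioo (a - ε) b, HasDerivAt Ψ (F (s, Ψ s)) s := by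
  have hneg : ∀ (f : ℝ → ℝ) (d s : ℝ), HasDerivAt f d (-s) →
      HasDerivAt (fun t => f (-t)) (-d) s := fun f d s hf => by
    exact (hf.comp s (hasDerivAt_neg s)).congr_deriv (mul_neg_one d)
  have hF' : ContDiffAt ℝ 1 (fun p : ℝ × ℝ => -F (-p.1, p.2)) (-a, L) := by
    refine ContDiffAt.neg (ContDiffAt.comp (-a, L) (f := fun p : ℝ × ℝ => (-p.1, p.2)) ?_ ?_)
    · simpa using hF
    · exact contDiffAt_fst.neg.prodMk contDiffAt_snd
  obtain ⟨ε, hε, Ψ, hΨ, hd⟩ := exists_extension_right (Φ := fun t => Φ (-t)) (I := Neg.neg ⁻¹' I)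
    hF' (neg_lt_neg hab) (hI.preimage continuous_neg)
    (fun s hs => by have := hIa hs; simp only [mem_Ioi, mem_Iio] at *; linarith)
    (fun s hs => habI ⟨by linarith [hs.2], by linarith [hs.1]⟩)
    (fun s hs => hneg _ _ _ (hΦ _ hs))
    (hlim.comp (by simpa using tendsto_neg_nhdsLT (a := -a)))
  refine ⟨ε, hε, fun t => Ψ (-t), fun s hs => ?_, fun s hs => ?_⟩
  · simpa using hΨ (show -s ∈ Neg.neg ⁻¹' I by simpa using hs)
  · have hs' : -s ∈ Neg.neg ⁻¹' I ∪ Ioo (-b) (-a + ε) := by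
      rcases hs with hs | hs
      · exact Or.inl (by simpa using hs)
      · exact Or.inr ⟨by linarith [hs.2], by linarith [hs.1]⟩
    simpa using hneg _ _ _ (hd _ hs')

end Continuation

section PowerComparison

variable {h R : ℝ → ℝ} {D : Set ℝ} {k : ℝ}

lemma hasDerivAt_mul_rpow {s : ℝ} (hs : 0 < s) (hd : HasDerivAt h (-(h s * R s) / s) s) :
    HasDerivAt (fun s => h s * s ^ k) (h s * s ^ (k - 1) * (k - R s)) s := by
  refine (hd.mul (Real.hasDerivAt_rpow_const (p := k) (Or.inl hs.ne'))).congr_deriv ?_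
  rw [Real.rpow_sub_one hs.ne']
  field_simp
  ring

lemma antitoneOn_mul_rpow (hD : IsOpen D) (hconv : Convex ℝ D) (hpos : D ⊆ Ioi 0)
    (hh : ∀ s ∈ D, 0 < h s) (hd : ∀ s ∈ D, HasDerivAt h (-(h s * R s) / s) s)
    (hk : ∀ s ∈ D, k ≤ R s) : AntitoneOn (fun s => h s * s ^ k) D := by
  have key := fun s hs => hasDerivAt_mul_rpow (k := k) (hpos hs) (hd s hs)
  refine antitoneOn_of_deriv_nonpos hconv
    (fun s hs => (key s hs).continuousAt.continuousWithinAt) ?_ ?_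
  · exact fun s hs => (key s (interior_subset hs)).differentiableAt.differentiableWithinAt
  · intro s hs
    rw [hD.interior_eq] at hs
    rw [(key s hs).deriv]
    have h₁ := hh s hs
    have h₂ := Real.rpow_pos_of_pos (hpos hs) (k - 1)
    exact mul_nonpos_of_nonneg_of_nonpos (by positivity) (by linarith [hk s hs])

lemma monotoneOn_mul_rpow (hD : IsOpen D) (hconv : Convex ℝ D) (hpos : D ⊆ Ioi 0)
    (hh : ∀ s ∈ D, 0 < h s) (hd : ∀ s ∈ D, HasDerivAt h (-(h s * R s) / s) s)
    (hk : ∀ s ∈ D, R s ≤ k) : MonotoneOn (fun s => h s * s ^ k) D := by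
  have key := fun s hs => hasDerivAt_mul_rpow (k := k) (hpos hs) (hd s hs)
  refine monotoneOn_of_deriv_nonneg hconv
    (fun s hs => (key s hs).continuousAt.continuousWithinAt) ?_ ?_
  · exact fun s hs => (key s (interior_subset hs)).differentiableAt.differentiableWithinAt
  · intro s hs
    rw [hD.interior_eq] at hs
    rw [(key s hs).deriv]
    have h₁ := hh s hs
    have h₂ := Real.rpow_pos_of_pos (hpos hs) (k - 1)
    exact mul_nonneg (by positivity) (by linarith [hk s hs])

end PowerComparison

section Equation

variable {c γ : ℝ} {Φ : ℝ → ℝ} {I : Set ℝ}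

lemma one_lt_of_inv_lt {y : ℝ} (hc0 : 0 < c) (hc1 : c < 1) (hy : 1 / c < y) : 1 < y :=
  ((one_lt_div hc0).mpr hc1).trans hy

lemma contDiffAt_fieldB {s y : ℝ} (hγ : 0 < γ) (hs : 0 < s) (hy : 1 < y) :
    ContDiffAt ℝ 1 (fieldB c γ) (s, y) := by
  unfold fieldB
  refine ContDiffAt.div (by fun_prop) (by fun_prop) ?_
  have h₁ : 0 < y - 1 := by linarith
  have h₂ : 0 < 1 + c ^ 2 * γ * s ^ 2 * y ^ 3 := by positivity
  simp only
  positivity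

lemma le_rateB {s y : ℝ} (hc0 : 0 < c) (hc1 : c < 1) (hγ : 0 < γ) (hy : 1 < y) :
    c ≤ rateB c γ s y := by
  have h₁ : 0 < y - 1 := by linarith
  have h₂ : 0 < 1 - c := by linarith
  have h₃ : 0 < 1 + c ^ 2 * γ * s ^ 2 * y ^ 3 := by positivity
  rw [rateB, le_div_iff₀ (by positivity)]
  have : 0 ≤ c * (c * y ^ 2 + 1 + γ * s ^ 2 * y ^ 3 * (c * y * (1 - c) + 1 + c ^ 2)) := by
    positivity
  linarith

lemma exists_rateB_le {s₀ : ℝ} (hc0 : 0 < c) (hc1 : c < 1) (hγ : 0 < γ) (hs₀ : 0 < s₀) :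
    ∃ K > 0, ∀ s ≥ s₀, ∀ y > 1 / c, rateB c γ s y ≤ K := by
  have hc : 0 < 1 - c := by linarith
  refine ⟨c * (1 / c ^ 2 + 1 / (γ * s₀ ^ 2)) * (2 * c / (1 - c)), by positivity,
    fun s hs y hy => ?_⟩
  have hy1 : 1 < y := one_lt_of_inv_lt hc0 hc1 hy
  have hcy : 1 < c * y := by
    rw [gt_iff_lt, div_lt_iff₀ hc0] at hy
    linarith
  have h₁ : 0 < y - 1 := by linarith
  have hs0 : 0 < s := hs₀.trans_le hs
  have h₃ : 0 < 1 + c ^ 2 * γ * s ^ 2 * y ^ 3 := by positivity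
  have hA : y * (1 + γ * s ^ 2 * y ^ 2) ≤
      (1 / c ^ 2 + 1 / (γ * s₀ ^ 2)) * (1 + c ^ 2 * γ * s ^ 2 * y ^ 3) := by
    have e : (1 / c ^ 2 + 1 / (γ * s₀ ^ 2)) * (1 + c ^ 2 * γ * s ^ 2 * y ^ 3) =
        1 / c ^ 2 + 1 / (γ * s₀ ^ 2) + γ * s ^ 2 * y ^ 3 + (c * y) ^ 2 * (s / s₀) ^ 2 * y := by
      field_simp
      ring
    have h₄ : 1 ≤ (s / s₀) ^ 2 := one_le_pow₀ ((one_le_div hs₀).mpr hs)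
    have h₅ : 1 ≤ (c * y) ^ 2 := one_le_pow₀ hcy.le
    have h₆ : y ≤ (c * y) ^ 2 * (s / s₀) ^ 2 * y :=
      le_mul_of_one_le_left (by linarith) (one_le_mul_of_one_le_of_one_le h₅ h₄)
    have h₇ : 0 < 1 / c ^ 2 + 1 / (γ * s₀ ^ 2) := by positivity
    rw [e]
    linarith
  have hB : c * y + 1 ≤ 2 * c / (1 - c) * (y - 1) := by
    rw [div_mul_eq_mul_div, le_div_iff₀ hc]
    nlinarith
  rw [rateB, div_le_iff₀ (by positivity)]
  have := mul_le_mul hA hB (by positivity) (by positivity)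
  have := mul_le_mul_of_nonneg_left this hc0.le
  linarith

lemma SolvesB.hasDerivAt_sub_one (hΦ : SolvesB c γ Φ I) {s : ℝ} (hs : s ∈ I) :
    HasDerivAt (fun s => c * Φ s - 1) (-((c * Φ s - 1) * rateB c γ s (Φ s)) / s) s := by
  refine (((hΦ s hs).const_mul c).sub_const 1).congr_deriv ?_
  simp only [rateB, div_eq_mul_inv, mul_inv]
  ring

lemma SolvesB.inv_lt_of_ge (hΦ : SolvesB c γ Φ I) (hc0 : 0 < c) (hc1 : c < 1) (hγ : 0 < γ)
    (h1 : 1 / c < Φ 1) {s : ℝ} (hs : 1 ≤ s) (hI : Icc 1 s ⊆ I) : 1 / c < Φ s := by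
  obtain ⟨K, hK, hle⟩ := exists_rateB_le hc0 hc1 hγ one_pos
  have h0 : 0 < c * Φ 1 - 1 := by
    rw [div_lt_iff₀ hc0] at h1
    linarith
  have hpow : ∀ x ∈ Icc 1 s, HasDerivAt (fun x => -((c * Φ 1 - 1) * x ^ (-(K + 1))))
      ((K + 1) * ((c * Φ 1 - 1) * x ^ (-(K + 1))) / x) x := fun x hx => by
    have hx0 : 0 < x := one_pos.trans_le hx.1
    refine (((Real.hasDerivAt_rpow_const (p := -(K + 1)) (Or.inl hx0.ne')).const_mul
      (c * Φ 1 - 1)).neg).congr_deriv ?_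
    rw [Real.rpow_sub_one hx0.ne']
    ring
  have key := image_le_of_deriv_right_lt_deriv_boundary' (a := 1) (b := s)
    (f := fun x => -(c * Φ x - 1)) (f' := fun x => -(-((c * Φ x - 1) * rateB c γ x (Φ x)) / x))
    (B := fun x => -((c * Φ 1 - 1) * x ^ (-(K + 1))))
    (B' := fun x => (K + 1) * ((c * Φ 1 - 1) * x ^ (-(K + 1))) / x)
    (fun x hx => (hΦ.hasDerivAt_sub_one (hI hx)).neg.continuousAt.continuousWithinAt)
    (fun x hx => (hΦ.hasDerivAt_sub_one (hI (Ico_subset_Icc_self hx))).neg.hasDerivWithinAt)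
    (by simp) (fun x hx => (hpow x hx).continuousAt.continuousWithinAt)
    (fun x hx => (hpow x (Ico_subset_Icc_self hx)).hasDerivWithinAt)
    (fun x hx heq => by
      have hx0 : 0 < x := one_pos.trans_le hx.1
      have hv : 0 < (c * Φ 1 - 1) * x ^ (-(K + 1)) := mul_pos h0 (Real.rpow_pos_of_pos hx0 _)
      have heq' : c * Φ x - 1 = (c * Φ 1 - 1) * x ^ (-(K + 1)) := neg_injective heq
      rw [← heq'] at hv ⊢
      have hy : 1 / c < Φ x := by
        rw [div_lt_iff₀ hc0]
        linarith
      have hr := hle x hx.1 _ hy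
      rw [neg_div, neg_neg]
      refine (div_lt_div_iff_of_pos_right hx0).mpr ?_
      nlinarith)
    (right_mem_Icc.mpr hs)
  have hv : 0 < (c * Φ 1 - 1) * s ^ (-(K + 1)) :=
    mul_pos h0 (Real.rpow_pos_of_pos (one_pos.trans_le hs) _)
  rw [div_lt_iff₀ hc0]
  linarith

lemma SolvesB.inv_lt_of_le (hΦ : SolvesB c γ Φ I) (hc0 : 0 < c) (hc1 : c < 1) (hγ : 0 < γ)
    (h1 : 1 / c < Φ 1) {s : ℝ} (hs0 : 0 < s) (hs : s ≤ 1) (hI : Icc s 1 ⊆ I) : 1 / c < Φ s := by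
  by_contra! hle
  have h0 : 0 < c * Φ 1 - 1 := by
    rw [div_lt_iff₀ hc0] at h1
    linarith
  rw [le_div_iff₀ hc0] at hle
  have key := image_le_of_deriv_right_lt_deriv_boundary (a := s) (b := 1)
    (f := fun x => c * Φ x - 1) (f' := fun x => -((c * Φ x - 1) * rateB c γ x (Φ x)) / x)
    (B := fun _ => (c * Φ 1 - 1) / 2) (B' := fun _ => 0)
    (fun x hx => (hΦ.hasDerivAt_sub_one (hI hx)).continuousAt.continuousWithinAt)
    (fun x hx => (hΦ.hasDerivAt_sub_one (hI (Ico_subset_Icc_self hx))).hasDerivWithinAt)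
    (by linarith) (fun x => hasDerivAt_const x _)
    (fun x hx heq => by
      have hx0 : 0 < x := hs0.trans_le hx.1
      have hy : 1 / c < Φ x := by
        rw [div_lt_iff₀ hc0]
        linarith
      have hr := hc0.trans_le (le_rateB (s := x) hc0 hc1 hγ (one_lt_of_inv_lt hc0 hc1 hy))
      have hv : 0 < c * Φ x - 1 := by linarith
      rw [neg_div, neg_lt_zero]
      positivity)
    (right_mem_Icc.mpr hs)
  linarith

lemma SolvesB.inv_lt (hΦ : SolvesB c γ Φ I) (hc0 : 0 < c) (hc1 : c < 1) (hγ : 0 < γ)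
    (hI : I.OrdConnected) (hI0 : I ⊆ Ioi 0) (h1I : 1 ∈ I) (h1 : 1 / c < Φ 1) {s : ℝ}
    (hs : s ∈ I) : 1 / c < Φ s := by
  rcases le_total 1 s with h | h
  · exact hΦ.inv_lt_of_ge hc0 hc1 hγ h1 h (hI.out h1I hs)
  · exact hΦ.inv_lt_of_le hc0 hc1 hγ h1 (hI0 hs) h (hI.out hs h1I)

lemma SolvesB.strictAntiOn (hΦ : SolvesB c γ Φ I) (hc0 : 0 < c) (hc1 : c < 1) (hγ : 0 < γ)
    (hI : I.OrdConnected) (hI0 : I ⊆ Ioi 0) (hlt : ∀ s ∈ I, 1 / c < Φ s) : StrictAntiOn Φ I := by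
  have h : StrictAntiOn (fun s => c * Φ s - 1) I := by
    refine strictAntiOn_of_deriv_neg hI.convex
      (fun s hs => (hΦ.hasDerivAt_sub_one hs).continuousAt.continuousWithinAt) fun s hs => ?_
    replace hs := interior_subset hs
    have hs0 : 0 < s := hI0 hs
    have hy := hlt s hs
    have hr := hc0.trans_le (le_rateB (s := s) hc0 hc1 hγ (one_lt_of_inv_lt hc0 hc1 hy))
    rw [div_lt_iff₀ hc0] at hy
    have hv : 0 < c * Φ s - 1 := by linarith
    rw [(hΦ.hasDerivAt_sub_one hs).deriv, neg_div, neg_lt_zero]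
    positivity
  intro x hx y hy hxy
  have := h hx hy hxy
  simp only at this
  nlinarith

lemma IsMaximalBSolution.mem_of_one_lt (hmax : IsMaximalBSolution c γ Φ I) (hc0 : 0 < c)
    (hc1 : c < 1) (hγ : 0 < γ) (h1I : 1 ∈ I) (h1 : 1 / c < Φ 1) {t : ℝ} (ht : 1 < t) :
    t ∈ I := by
  obtain ⟨hIo, hIc, hI0, hΦ, hext⟩ := hmax
  by_contra htI
  have hlt := fun s hs => hΦ.inv_lt hc0 hc1 hγ hIc hI0 h1I h1 (s := s) hs
  have hanti := hΦ.strictAntiOn hc0 hc1 hγ hIc hI0 hlt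
  have hbdd : BddAbove I := ⟨t, fun s hs => by
    by_contra! h
    exact htI (hIc.out h1I hs ⟨ht.le, h.le⟩)⟩
  set b := sSup I with hb
  have hbI : b ∉ I := fun hbI => by
    obtain ⟨x, hx, hxI⟩ := ((eventually_mem_nhdsWithin (a := b) (s := Ioi b)).and
      (nhdsWithin_le_nhds (hIo.mem_nhds hbI))).exists
    exact absurd (le_csSup hbdd hxI) (not_le.mpr hx)
  have hIb : I ⊆ Iio b := fun s hs =>
    (le_csSup hbdd hs).lt_of_ne fun h => hbI (hb ▸ h ▸ hs)
  have h1b : 1 < b := hIb h1I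
  have hIoo : Ioo 1 b ⊆ I := fun s hs => by
    obtain ⟨x, hx, hsx⟩ := exists_lt_of_lt_csSup ⟨1, h1I⟩ hs.2
    exact hIc.out h1I hx ⟨hs.1.le, hsx.le⟩
  obtain ⟨K, hK, hle⟩ := exists_rateB_le hc0 hc1 hγ (s₀ := 1 / 2) (by norm_num)
  have hD := monotoneOn_mul_rpow (D := I ∩ Ioi (1 / 2)) (k := K) (h := fun s => c * Φ s - 1)
    (R := fun s => rateB c γ s (Φ s)) (hIo.inter isOpen_Ioi)
    (hIc.inter ordConnected_Ioi).convex (inter_subset_left.trans hI0)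
    (fun s hs => by
      have := hlt s hs.1
      rw [div_lt_iff₀ hc0] at this
      linarith)
    (fun s hs => hΦ.hasDerivAt_sub_one hs.1) (fun s hs => hle s (le_of_lt hs.2) _ (hlt s hs.1))
  have h0 : 0 < c * Φ 1 - 1 := by
    rw [div_lt_iff₀ hc0] at h1
    linarith
  have hbK : 0 < b ^ K := Real.rpow_pos_of_pos (by linarith) K
  have hlow : ∀ s ∈ Ioo 1 b, (1 + (c * Φ 1 - 1) / b ^ K) / c ≤ Φ s := fun s hs => by
    have hm := hD ⟨h1I, by norm_num⟩ ⟨hIoo hs, by simp only [mem_Ioi]; linarith [hs.1]⟩ hs.1.le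
    simp only [Real.one_rpow, mul_one] at hm
    have hsK : s ^ K ≤ b ^ K := Real.rpow_le_rpow (by linarith [hs.1]) hs.2.le hK.le
    have hv := hlt s (hIoo hs)
    rw [div_lt_iff₀ hc0] at hv
    have : (c * Φ 1 - 1) / b ^ K ≤ c * Φ s - 1 := by
      rw [div_le_iff₀ hbK]
      exact hm.trans (mul_le_mul_of_nonneg_left hsK (by linarith))
    rw [div_le_iff₀ hc0]
    linarith
  have hlim := (hanti.antitoneOn.mono hIoo).tendsto_nhdsWithin_Ioo_left (nonempty_Ioo.mpr h1b)
    ⟨_, forall_mem_image.mpr hlow⟩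
  set L := sInf (Φ '' Ioo 1 b)
  have hL : 1 / c < L := by
    refine lt_of_lt_of_le ?_ (le_csInf ((nonempty_Ioo.mpr h1b).image Φ)
      (forall_mem_image.mpr hlow))
    exact (div_lt_div_iff_of_pos_right hc0).mpr (lt_add_of_pos_right 1 (by positivity))
  obtain ⟨ε, hε, Ψ, hΨ, hd⟩ := exists_extension_right
    (contDiffAt_fieldB hγ (by linarith) (one_lt_of_inv_lt hc0 hc1 hL)) h1b hIo hIb hIoo hΦ hlim
  obtain ⟨m, hm⟩ := nonempty_Ioo.mpr h1b
  have hJ := hext Ψ (I ∪ Ioo 1 (b + ε)) (hIo.union isOpen_Ioo)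
    (IsPreconnected.union (t := Ioo 1 (b + ε)) m (hIoo hm) ⟨hm.1, by linarith [hm.2]⟩
      hIc.isPreconnected isPreconnected_Ioo).ordConnected
    (union_subset hI0 fun s hs => one_pos.trans hs.1) hd subset_union_left hΨ
  exact hbI (hJ.subset (Or.inr ⟨h1b, by linarith⟩))

lemma IsMaximalBSolution.mem_of_lt_one (hmax : IsMaximalBSolution c γ Φ I) (hc0 : 0 < c)
    (hc1 : c < 1) (hγ : 0 < γ) (h1I : 1 ∈ I) (h1 : 1 / c < Φ 1) {t : ℝ} (ht0 : 0 < t)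
    (ht : t < 1) : t ∈ I := by
  obtain ⟨hIo, hIc, hI0, hΦ, hext⟩ := hmax
  by_contra htI
  have hlt := fun s hs => hΦ.inv_lt hc0 hc1 hγ hIc hI0 h1I h1 (s := s) hs
  have hanti := hΦ.strictAntiOn hc0 hc1 hγ hIc hI0 hlt
  have hlow : ∀ s ∈ I, t ≤ s := fun s hs => by
    by_contra! h
    exact htI (hIc.out hs h1I ⟨h.le, ht.le⟩)
  have hbdd : BddBelow I := ⟨t, hlow⟩
  set a := sInf I with ha
  have haI : a ∉ I := fun haI => by
    obtain ⟨x, hx, hxI⟩ := ((eventually_mem_nhdsWithin (a := a) (s := Iio a)).and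
      (nhdsWithin_le_nhds (hIo.mem_nhds haI))).exists
    exact absurd (csInf_le hbdd hxI) (not_le.mpr hx)
  have hIa : I ⊆ Ioi a := fun s hs =>
    (csInf_le hbdd hs).lt_of_ne fun h => haI (ha ▸ h ▸ hs)
  have ha1 : a < 1 := hIa h1I
  have ha0 : 0 < a := ht0.trans_le (le_csInf ⟨1, h1I⟩ hlow)
  have hIoo : Ioo a 1 ⊆ I := fun s hs => by
    obtain ⟨x, hx, hsx⟩ := exists_lt_of_csInf_lt ⟨1, h1I⟩ hs.1
    exact hIc.out hx h1I ⟨hsx.le, hs.2.le⟩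
  obtain ⟨K, hK, hle⟩ := exists_rateB_le hc0 hc1 hγ ha0
  have hD := monotoneOn_mul_rpow (D := I) (k := K) (h := fun s => c * Φ s - 1)
    (R := fun s => rateB c γ s (Φ s)) hIo hIc.convex hI0
    (fun s hs => by
      have := hlt s hs
      rw [div_lt_iff₀ hc0] at this
      linarith)
    (fun s hs => hΦ.hasDerivAt_sub_one hs) (fun s hs => hle s (le_of_lt (hIa hs)) _ (hlt s hs))
  have haK : 0 < a ^ K := Real.rpow_pos_of_pos ha0 K
  have hup : ∀ s ∈ Ioo a 1, Φ s ≤ (1 + (c * Φ 1 - 1) / a ^ K) / c := fun s hs => by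
    have hm := hD (hIoo hs) h1I hs.2.le
    simp only [Real.one_rpow, mul_one] at hm
    have hsK : a ^ K ≤ s ^ K := Real.rpow_le_rpow ha0.le hs.1.le hK.le
    have hv := hlt s (hIoo hs)
    rw [div_lt_iff₀ hc0] at hv
    have : c * Φ s - 1 ≤ (c * Φ 1 - 1) / a ^ K := by
      rw [le_div_iff₀ haK]
      exact (mul_le_mul_of_nonneg_left hsK (by linarith)).trans hm
    rw [le_div_iff₀ hc0]
    linarith
  have hbddΦ : BddAbove (Φ '' Ioo a 1) := ⟨_, forall_mem_image.mpr hup⟩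
  have hlim := (hanti.antitoneOn.mono hIoo).tendsto_nhdsWithin_Ioo_right (nonempty_Ioo.mpr ha1)
    hbddΦ
  set L := sSup (Φ '' Ioo a 1)
  obtain ⟨m, hm⟩ := nonempty_Ioo.mpr ha1
  have hL : 1 / c < L := (hlt m (hIoo hm)).trans_le (le_csSup hbddΦ (mem_image_of_mem Φ hm))
  obtain ⟨ε, hε, Ψ, hΨ, hd⟩ := exists_extension_left
    (contDiffAt_fieldB hγ ha0 (one_lt_of_inv_lt hc0 hc1 hL)) ha1 hIo hIa hIoo hΦ hlim
  have hmax_lt : max (a - ε) 0 < a := max_lt (by linarith) ha0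
  have hJ := hext Ψ (I ∪ Ioo (max (a - ε) 0) 1) (hIo.union isOpen_Ioo)
    (IsPreconnected.union (t := Ioo (max (a - ε) 0) 1) m (hIoo hm) ⟨hmax_lt.trans hm.1, hm.2⟩
      hIc.isPreconnected isPreconnected_Ioo).ordConnected
    (union_subset hI0 fun s hs => (le_max_right _ _).trans_lt hs.1)
    (fun s hs => hd s (union_subset_union_right I (Ioo_subset_Ioo_left (le_max_left _ _)) hs))
    subset_union_left hΨ
  exact haI (hJ.subset (Or.inr ⟨hmax_lt, ha1⟩))

lemma IsMaximalBSolution.eq_Ioi (hmax : IsMaximalBSolution c γ Φ I) (hc0 : 0 < c)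
    (hc1 : c < 1) (hγ : 0 < γ) (h1I : 1 ∈ I) (h1 : 1 / c < Φ 1) : I = Ioi 0 := by
  refine hmax.2.2.1.antisymm fun t ht => ?_
  rcases lt_trichotomy t 1 with h | rfl | h
  · exact hmax.mem_of_lt_one hc0 hc1 hγ h1I h1 ht h
  · exact h1I
  · exact hmax.mem_of_one_lt hc0 hc1 hγ h1I h1 h

end Equation

/-- For `0 < c < 1`, `γ > 0`, `q > 1/c`, a maximal solution `Φ` of (B)
with `Φ(1) = q` has maximal interval `(0,∞)`, is strictly decreasing with `Φ(s) > 1/c`,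
tends to `1/c` at `∞` and to `+∞` at `0+`, and is a decreasing diffeomorphism of
`(0,∞)` onto `(1/c, +∞)`. -/
theorem stmt13 (c γ q : ℝ) (hc0 : 0 < c) (hc1 : c < 1) (hγ : 0 < γ)
    (hq : 1 / c < q)
    (Φ : ℝ → ℝ) (I : Set ℝ) (hmax : IsMaximalBSolution c γ Φ I)
    (h1 : (1 : ℝ) ∈ I) (hΦ1 : Φ 1 = q) :
    I = Set.Ioi 0 ∧ StrictAntiOn Φ (Set.Ioi 0) ∧
      (∀ s : ℝ, 0 < s → 1 / c < Φ s) ∧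
      Filter.Tendsto Φ Filter.atTop (nhds (1 / c)) ∧
      Filter.Tendsto Φ (nhdsWithin 0 (Set.Ioi 0)) Filter.atTop ∧
      Φ '' Set.Ioi 0 = Set.Ioi (1 / c) := by
  have h1' : 1 / c < Φ 1 := hΦ1 ▸ hq
  obtain rfl := hmax.eq_Ioi hc0 hc1 hγ h1 h1'
  obtain ⟨-, hIc, hI0, hΦ, -⟩ := hmax
  have hlt : ∀ s ∈ Ioi (0 : ℝ), 1 / c < Φ s := fun s hs =>
    hΦ.inv_lt hc0 hc1 hγ hIc hI0 h1 h1' hs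
  have hpos : ∀ s ∈ Ioi (0 : ℝ), 0 < c * Φ s - 1 := fun s hs => by
    have := hlt s hs
    rw [div_lt_iff₀ hc0] at this
    linarith
  have hD := antitoneOn_mul_rpow (k := c) (h := fun s => c * Φ s - 1)
    (R := fun s => rateB c γ s (Φ s)) isOpen_Ioi (convex_Ioi 0) hI0 hpos
    (fun s hs => hΦ.hasDerivAt_sub_one hs)
    (fun s hs => le_rateB hc0 hc1 hγ (one_lt_of_inv_lt hc0 hc1 (hlt s hs)))
  have htop : Tendsto Φ atTop (nhds (1 / c)) := by
    have hup : Tendsto (fun s : ℝ => ((c * Φ 1 - 1) * s ^ (-c) + 1) / c) atTop (nhds (1 / c)) := by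
      simpa using (((tendsto_rpow_neg_atTop hc0).const_mul (c * Φ 1 - 1)).add_const 1).div_const c
    refine tendsto_of_tendsto_of_tendsto_of_le_of_le' tendsto_const_nhds hup ?_ ?_
    · filter_upwards [eventually_gt_atTop 0] with s hs using (hlt s hs).le
    · filter_upwards [eventually_ge_atTop 1] with s hs
      have hs0 : 0 < s := one_pos.trans_le hs
      have hm := hD h1 hs0 hs
      simp only [Real.one_rpow, mul_one] at hm
      rw [le_div_iff₀ hc0, Real.rpow_neg hs0.le, ← div_eq_mul_inv]
      have := (le_div_iff₀ (Real.rpow_pos_of_pos hs0 c)).mpr hm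
      linarith
  have hzero : Tendsto Φ (nhdsWithin 0 (Ioi 0)) atTop := by
    have hlow : Tendsto (fun s : ℝ => ((c * Φ 1 - 1) * s ^ (-c) + 1) / c)
        (nhdsWithin 0 (Ioi 0)) atTop :=
      (tendsto_atTop_add_const_right _ 1
        ((tendsto_rpow_neg_nhdsGT_zero (neg_lt_zero.mpr hc0)).const_mul_atTop
          (hpos 1 h1))).atTop_div_const hc0
    refine tendsto_atTop_mono' _ ?_ hlow
    filter_upwards [Ioo_mem_nhdsGT one_pos] with s hs
    have hm := hD hs.1 h1 hs.2.le
    simp only [Real.one_rpow, mul_one] at hm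
    rw [div_le_iff₀ hc0, Real.rpow_neg hs.1.le, ← div_eq_mul_inv]
    have := (div_le_iff₀ (Real.rpow_pos_of_pos hs.1 c)).mpr hm
    linarith
  refine ⟨rfl, hΦ.strictAntiOn hc0 hc1 hγ hIc hI0 hlt, hlt, htop, hzero, ?_⟩
  refine (image_subset_iff.mpr hlt).antisymm ?_
  exact isPreconnected_Ioi.intermediate_value_Ioi (le_principal_iff.mpr (Ioi_mem_atTop 0))
    (le_principal_iff.mpr self_mem_nhdsWithin)
    (fun s hs => (hΦ s hs).continuousAt.continuousWithinAt) htop hzero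

end
end

section
/- Let 0 < c < 1 and γ > 0. For q > 1/c, let Φ_q denote the solution of the ODE (B) on (0,∞) with Φ_q(1) = q. Then for every fixed s > 0: (i) for every M > 0 there exists Q > 1/c such that Φ_q(s) > M whenever q > Q (i.e. lim_{q→∞} Φ_q(s) = +∞); and (ii) for every ε > 0 there exists δ > 0 such that Φ_q(s) < 1/c + ε whenever 1/c < q < 1/c + δ (i.e. lim_{q↓1/c} Φ_q(s) = 1/c). -/
open Set Filter

noncomputable section

/-- The right-hand side of (B) is nonpositive above `1/c`, and for `s` bounded away from `0` it is
bounded by a constant multiple of the distance of the value to the constant solution `1/c`. -/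
theorem exists_bound_rhsB (c γ a : ℝ) (hc0 : 0 < c) (hc1 : c < 1) (hγ : 0 < γ) (ha : 0 < a) :
    ∃ L : ℝ, ∀ s y : ℝ, a ≤ s → 1 / c < y →
      -(y * (c ^ 2 * y ^ 2 - 1) * (1 + γ * s ^ 2 * y ^ 2)) /
        (s * (y - 1) * (1 + c ^ 2 * γ * s ^ 2 * y ^ 3)) ≤ 0 ∧
      -(L * (y - 1 / c)) ≤ -(y * (c ^ 2 * y ^ 2 - 1) * (1 + γ * s ^ 2 * y ^ 2)) /
        (s * (y - 1) * (1 + c ^ 2 * γ * s ^ 2 * y ^ 3)) := by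
  set P : ℝ := 1 / c ^ 2 + 1 / (γ * a ^ 2) with hP
  have hP0 : 0 < P := by positivity
  have h1c : 0 < 1 - c := sub_pos.2 hc1
  refine ⟨2 * c ^ 2 * P / ((1 - c) * a), fun s y hs hy => ?_⟩
  have hs0 : 0 < s := ha.trans_le hs
  have hy0 : 0 < y := lt_trans (by positivity) hy
  have hcy : 1 < c * y := by
    rw [div_lt_iff₀ hc0] at hy
    linarith
  have hsub : (1 - c) * y ≤ y - 1 := by linarith
  have hy1 : 0 < y - 1 := lt_of_lt_of_le (by positivity) hsub
  have hD : 0 < 1 + c ^ 2 * γ * s ^ 2 * y ^ 3 := by positivity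
  have hfac : c ^ 2 * y ^ 2 - 1 = (c * y - 1) * (c * y + 1) := by ring
  have hcy0 : 0 < c * y - 1 := by linarith
  have hbase : y * (1 + γ * s ^ 2 * y ^ 2) ≤ P * (1 + c ^ 2 * γ * s ^ 2 * y ^ 3) := by
    have e : P * (1 + c ^ 2 * γ * s ^ 2 * y ^ 3) =
        P + γ * s ^ 2 * y ^ 3 + (s ^ 2 / a ^ 2) * (c * y) ^ 2 * y := by
      rw [hP]
      field_simp
      ring
    have h1 : 1 ≤ s ^ 2 / a ^ 2 := by
      rw [one_le_div (by positivity)]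
      gcongr
    have h2 : 1 ≤ (s ^ 2 / a ^ 2) * (c * y) ^ 2 :=
      one_le_mul_of_one_le_of_one_le h1 (one_le_pow₀ hcy.le)
    have h3 := mul_le_mul_of_nonneg_right h2 hy0.le
    rw [e]
    linarith
  rw [hfac, neg_div, neg_nonpos, neg_le_neg_iff]
  refine ⟨by positivity, ?_⟩
  rw [div_le_iff₀ (by positivity)]
  calc y * ((c * y - 1) * (c * y + 1)) * (1 + γ * s ^ 2 * y ^ 2)
      = (c * y - 1) * (c * y + 1) * (y * (1 + γ * s ^ 2 * y ^ 2)) := by ring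
    _ ≤ (c * y - 1) * (2 * (c * y)) * (P * (1 + c ^ 2 * γ * s ^ 2 * y ^ 3)) := by
        gcongr
        linarith
    _ = (c * y - 1) * (2 * c * P) * (1 + c ^ 2 * γ * s ^ 2 * y ^ 3) / ((1 - c) * a) *
          (a * ((1 - c) * y)) := by
        field_simp
    _ ≤ (c * y - 1) * (2 * c * P) * (1 + c ^ 2 * γ * s ^ 2 * y ^ 3) / ((1 - c) * a) *
          (s * (y - 1)) := by
        gcongr
    _ = 2 * c ^ 2 * P / ((1 - c) * a) * (y - 1 / c) *
          (s * (y - 1) * (1 + c ^ 2 * γ * s ^ 2 * y ^ 3)) := by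
        field_simp

/-- Solutions of (B) above `1/c` decrease, and `Φ - 1/c` decays at most exponentially away
from `0`, at a rate that does not depend on the solution. -/
theorem exists_harnack_of_solvesB (c γ a b : ℝ) (hc0 : 0 < c) (hc1 : c < 1) (hγ : 0 < γ)
    (ha : 0 < a) (hab : a ≤ b) :
    ∃ C : ℝ, 1 ≤ C ∧ ∀ Φ : ℝ → ℝ, SolvesB c γ Φ (Ioi 0) → (∀ x : ℝ, 0 < x → 1 / c < Φ x) →
      Φ b ≤ Φ a ∧ Φ a - 1 / c ≤ C * (Φ b - 1 / c) := by
  obtain ⟨L, hL⟩ := exists_bound_rhsB c γ a hc0 hc1 hγ ha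
  have hpos : ∀ x ∈ Ici a, 0 < x := fun x hx => ha.trans_le hx
  refine ⟨max 1 (Real.exp (L * (b - a))), le_max_left _ _, fun Φ hΦ hgt => ⟨?_, ?_⟩⟩
  · have hanti : AntitoneOn Φ (Ici a) := by
      refine antitoneOn_of_hasDerivWithinAt_nonpos (convex_Ici a)
        (fun x hx => (hΦ x (hpos x hx)).continuousAt.continuousWithinAt)
        (fun x hx => (hΦ x (hpos x (interior_subset hx))).hasDerivWithinAt)
        (fun x hx => (hL x _ (interior_subset hx) (hgt x (hpos x (interior_subset hx)))).1)
    exact hanti self_mem_Ici hab hab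
  · have hderiv := fun x (hx : x ∈ Ici a) =>
      ((hΦ x (hpos x hx)).sub_const (1 / c)).mul (((hasDerivAt_id x).const_mul L).exp)
    have hmono : MonotoneOn ((fun x => Φ x - 1 / c) * fun x => Real.exp (L * id x)) (Ici a) := by
      refine monotoneOn_of_hasDerivWithinAt_nonneg (convex_Ici a)
        (fun x hx => (hderiv x hx).continuousAt.continuousWithinAt)
        (fun x hx => (hderiv x (interior_subset hx)).hasDerivWithinAt) (fun x hx => ?_)
      have hx' := interior_subset hx
      have h := (hL x _ hx' (hgt x (hpos x hx'))).2
      have h' := mul_nonneg (neg_le_iff_add_nonneg.1 h) (Real.exp_pos (L * id x)).le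
      exact h'.trans_eq (by ring)
    have h := hmono self_mem_Ici hab hab
    simp only [Pi.mul_apply, id] at h
    have hb : 0 < Φ b - 1 / c := sub_pos.2 (hgt b (ha.trans_le hab))
    calc Φ a - 1 / c = (Φ a - 1 / c) * Real.exp (L * a) * Real.exp (-(L * a)) := by
          rw [mul_assoc, ← Real.exp_add, add_neg_cancel, Real.exp_zero, mul_one]
      _ ≤ (Φ b - 1 / c) * Real.exp (L * b) * Real.exp (-(L * a)) := by gcongr
      _ = Real.exp (L * (b - a)) * (Φ b - 1 / c) := by
          rw [mul_assoc, ← Real.exp_add, mul_comm, mul_sub L, sub_eq_add_neg (L * b)]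
      _ ≤ max 1 (Real.exp (L * (b - a))) * (Φ b - 1 / c) := by
          gcongr
          exact le_max_right _ _

/-- The distances to `1/c` of the values of a solution of (B) at `1` and at `s` are comparable,
uniformly in the solution. -/
theorem exists_two_sided_bound_of_solvesB (c γ s : ℝ) (hc0 : 0 < c) (hc1 : c < 1) (hγ : 0 < γ)
    (hs : 0 < s) :
    ∃ C : ℝ, 1 ≤ C ∧ ∀ Φ : ℝ → ℝ, SolvesB c γ Φ (Ioi 0) → (∀ x : ℝ, 0 < x → 1 / c < Φ x) →
      Φ 1 - 1 / c ≤ C * (Φ s - 1 / c) ∧ Φ s - 1 / c ≤ C * (Φ 1 - 1 / c) := by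
  have weaken : ∀ {C u v : ℝ}, 1 ≤ C → 0 < v → u ≤ v → u ≤ C * v := fun hC hv huv =>
    huv.trans (le_mul_of_one_le_left hv.le hC)
  rcases le_total s 1 with h | h
  · obtain ⟨C, hC, H⟩ := exists_harnack_of_solvesB c γ s 1 hc0 hc1 hγ hs h
    refine ⟨C, hC, fun Φ hΦ hgt => ⟨?_, (H Φ hΦ hgt).2⟩⟩
    exact weaken hC (sub_pos.2 (hgt s hs)) (sub_le_sub_right (H Φ hΦ hgt).1 _)
  · obtain ⟨C, hC, H⟩ := exists_harnack_of_solvesB c γ 1 s hc0 hc1 hγ one_pos h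
    refine ⟨C, hC, fun Φ hΦ hgt => ⟨(H Φ hΦ hgt).2, ?_⟩⟩
    exact weaken hC (sub_pos.2 (hgt 1 one_pos)) (sub_le_sub_right (H Φ hΦ hgt).1 _)

/-- For `0 < c < 1`, `γ > 0` and `q > 1/c`, let `Φ_q` denote the
(unique) solution of (B) on `(0,∞)` with values in `(1/c, ∞)` and `Φ_q(1) = q`. Then for
every fixed `s > 0`: (i) `lim_{q→∞} Φ_q(s) = +∞`, and (ii) `lim_{q↓1/c} Φ_q(s) = 1/c`. -/
theorem stmt14 (c γ : ℝ) (hc0 : 0 < c) (hc1 : c < 1) (hγ : 0 < γ) :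
    ∀ s : ℝ, 0 < s →
      (∀ M : ℝ, 0 < M → ∃ Q : ℝ, 1 / c < Q ∧ ∀ q : ℝ, Q < q →
        ∀ Φ : ℝ → ℝ, SolvesB c γ Φ (Set.Ioi 0) → (∀ x : ℝ, 0 < x → 1 / c < Φ x) →
          Φ 1 = q → M < Φ s) ∧
      (∀ ε : ℝ, 0 < ε → ∃ δ : ℝ, 0 < δ ∧ ∀ q : ℝ, 1 / c < q → q < 1 / c + δ →
        ∀ Φ : ℝ → ℝ, SolvesB c γ Φ (Set.Ioi 0) → (∀ x : ℝ, 0 < x → 1 / c < Φ x) →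
          Φ 1 = q → Φ s < 1 / c + ε) := by
  intro s hs
  obtain ⟨C, hC, H⟩ := exists_two_sided_bound_of_solvesB c γ s hc0 hc1 hγ hs
  have hC0 : 0 < C := one_pos.trans_le hC
  have hc : 0 < 1 / c := by positivity
  refine ⟨fun M hM => ⟨1 / c + C * M, lt_add_of_pos_right _ (by positivity), ?_⟩,
    fun ε hε => ⟨ε / C, by positivity, ?_⟩⟩
  · rintro q hq Φ hΦ hgt rfl
    have h : C * M < C * (Φ s - 1 / c) := (lt_sub_iff_add_lt'.2 hq).trans_le (H Φ hΦ hgt).1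
    linarith [lt_of_mul_lt_mul_left h hC0.le]
  · rintro q - hq Φ hΦ hgt rfl
    have h : C * (Φ 1 - 1 / c) < ε := (lt_div_iff₀' hC0).1 (sub_lt_iff_lt_add'.2 hq)
    linarith [(H Φ hΦ hgt).2]

end
end

section
/- Let 0 < c < 1 and γ > 0. For every q > 0 there exists a C² function H_q : [1,∞) → [1,∞) with H_q(1) = 1 and H_q'(1) = q which solves the ODE (EL) on [1,∞) and which is an increasing diffeomorphism of [1,∞) onto [1,∞). Moreover, for every r > 1 and every R > 1 there exists q > 0 such that H_q(r) = R, i.e. H_q restricts to an increasing diffeomorphism of [1,r] onto [1,R]. -/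
open Set Filter

noncomputable section

/-- A bounded, globally Lipschitz autonomous vector field on a Banach space has global integral
curves through every point. -/
lemma exists_integralCurve_of_lipschitz_of_bounded {E : Type*} [NormedAddCommGroup E]
    [NormedSpace ℝ E] [CompleteSpace E] {F : E → E} {K : NNReal} {B : ℝ}
    (hF : LipschitzWith K F) (hB : ∀ x, ‖F x‖ ≤ B) (x₀ : E) :
    ∃ f : ℝ → E, f 0 = x₀ ∧ ∀ t, HasDerivAt f (F (f t)) t := by
  have hB0 : 0 ≤ B := (norm_nonneg _).trans (hB x₀)
  have local_sol : ∀ n : ℕ, ∃ f : ℝ → E, f 0 = x₀ ∧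
      ∀ t ∈ Ioo (-(n + 1 : ℝ)) (n + 1), HasDerivAt f (F (f t)) t := by
    intro n
    have hn : (0 : ℝ) ∈ Icc (-(n + 1 : ℝ)) (n + 1) := by
      constructor <;> linarith [n.cast_nonneg (α := ℝ)]
    have hpl : IsPicardLindelof (fun _ ↦ F) (⟨0, hn⟩ : Icc (-(n + 1 : ℝ)) (n + 1)) x₀
        (B.toNNReal * (n + 1)) 0 B.toNNReal K :=
      { lipschitzOnWith := fun _ _ ↦ hF.lipschitzOnWith
        continuousOn := fun _ _ ↦ continuousOn_const
        norm_le := fun _ _ x _ ↦ (hB x).trans (Real.le_coe_toNNReal B)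
        mul_max_le := by simp }
    obtain ⟨f, hf0, hf⟩ := hpl.exists_eq_forall_mem_Icc_hasDerivWithinAt₀
    exact ⟨f, hf0, fun t ht ↦
      (hf t (Ioo_subset_Icc_self ht)).hasDerivAt (Icc_mem_nhds ht.1 ht.2)⟩
  choose f hf0 hf using local_sol
  have agree : ∀ m n : ℕ, m ≤ n → EqOn (f m) (f n) (Ioo (-(m + 1 : ℝ)) (m + 1)) := by
    intro m n hmn
    have hmn' : (m : ℝ) ≤ n := by exact_mod_cast hmn
    refine ODE_solution_unique_of_mem_Ioo (v := fun _ ↦ F) (s := fun _ ↦ univ) (t₀ := 0)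
      (fun _ _ ↦ hF.lipschitzOnWith) ⟨?_, ?_⟩ (fun t ht ↦ ⟨hf m t ht, trivial⟩)
      (fun t ht ↦ ⟨hf n t ⟨?_, ?_⟩, trivial⟩) (by rw [hf0, hf0])
    · linarith [m.cast_nonneg (α := ℝ)]
    · linarith [m.cast_nonneg (α := ℝ)]
    · linarith [ht.1]
    · linarith [ht.2]
  have mem : ∀ t : ℝ, t ∈ Ioo (-((⌈|t|⌉₊ : ℝ) + 1)) (⌈|t|⌉₊ + 1) := fun t ↦ by
    rw [mem_Ioo, ← abs_lt]
    linarith [Nat.le_ceil |t|]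
  refine ⟨fun t ↦ f ⌈|t|⌉₊ t, by simp [hf0], fun t ↦ ?_⟩
  refine (hf _ t (mem t)).congr_of_eventuallyEq ?_
  filter_upwards [Ioo_mem_nhds (mem t).1 (mem t).2] with s hs
  rcases le_total ⌈|s|⌉₊ ⌈|t|⌉₊ with h | h
  · exact agree _ _ h (mem s)
  · exact (agree _ _ h hs).symm

/-- Real-valued functions that are bounded and globally Lipschitz. -/
def BoundedLipschitz {X : Type*} [PseudoMetricSpace X] (f : X → ℝ) : Prop :=
  ∃ K : ℝ, (∀ p, |f p| ≤ K) ∧ ∀ p q, |f p - f q| ≤ K * dist p q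

namespace BoundedLipschitz

variable {X : Type*} [PseudoMetricSpace X] {f g : X → ℝ}

lemma add (hf : BoundedLipschitz f) (hg : BoundedLipschitz g) :
    BoundedLipschitz (fun p ↦ f p + g p) := by
  obtain ⟨K, hK, hK'⟩ := hf
  obtain ⟨L, hL, hL'⟩ := hg
  refine ⟨K + L, fun p ↦ (abs_add_le _ _).trans (add_le_add (hK p) (hL p)), fun p q ↦ ?_⟩
  calc |f p + g p - (f q + g q)| = |(f p - f q) + (g p - g q)| := by ring_nf
    _ ≤ |f p - f q| + |g p - g q| := abs_add_le _ _
    _ ≤ K * dist p q + L * dist p q := add_le_add (hK' p q) (hL' p q)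
    _ = (K + L) * dist p q := by ring

lemma mul (hf : BoundedLipschitz f) (hg : BoundedLipschitz g) :
    BoundedLipschitz (fun p ↦ f p * g p) := by
  obtain ⟨K, hK, hK'⟩ := hf
  obtain ⟨L, hL, hL'⟩ := hg
  refine ⟨K * L + K * L, fun p ↦ ?_, fun p q ↦ ?_⟩
  · have hK0 : 0 ≤ K := (abs_nonneg _).trans (hK p)
    have hL0 : 0 ≤ L := (abs_nonneg _).trans (hL p)
    rw [abs_mul]
    have := mul_le_mul (hK p) (hL p) (abs_nonneg _) hK0
    linarith [mul_nonneg hK0 hL0]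
  · have hK0 : 0 ≤ K := (abs_nonneg _).trans (hK p)
    calc |f p * g p - f q * g q| = |f p * (g p - g q) + (f p - f q) * g q| := by ring_nf
      _ ≤ |f p| * |g p - g q| + |f p - f q| * |g q| := by
        rw [← abs_mul, ← abs_mul]; exact abs_add_le _ _
      _ ≤ K * (L * dist p q) + (K * dist p q) * L := by
        gcongr
        · exact hK p
        · exact hL' p q
        · exact hK' p q
        · exact hL q
      _ = (K * L + K * L) * dist p q := by ring

end BoundedLipschitz

/-- Truncation of a real number to the interval `[-D, D]`. -/
def clamp (D y : ℝ) : ℝ := max (-D) (min D y)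

lemma clamp_of_abs_le {D y : ℝ} (h : |y| ≤ D) : clamp D y = y := by
  rw [abs_le] at h
  rw [clamp, min_eq_right h.2, max_eq_right h.1]

lemma clamp_nonneg_of_nonneg {D y : ℝ} (hD : 0 ≤ D) (h : 0 ≤ y) : 0 ≤ clamp D y :=
  le_max_of_le_right (le_min hD h)

lemma clamp_nonpos_of_nonpos {D y : ℝ} (hD : 0 ≤ D) (h : y ≤ 0) : clamp D y ≤ 0 :=
  max_le (neg_nonpos.2 hD) (min_le_of_right_le h)

lemma clamp_mem_Icc {D : ℝ} (hD : 0 ≤ D) (y : ℝ) : clamp D y ∈ Icc (-D) D :=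
  ⟨le_max_left _ _, max_le (by linarith) (min_le_left _ _)⟩

lemma lipschitzWith_clamp (D : ℝ) : LipschitzWith 1 (clamp D) :=
  (LipschitzWith.id.const_min D).const_max (-D)

lemma boundedLipschitz_comp_clamp {g : ℝ → ℝ} (hg : ContDiff ℝ 1 g) {D : ℝ} (hD : 0 ≤ D) :
    BoundedLipschitz (fun p : ℝ × ℝ ↦ g (clamp D p.1)) := by
  obtain ⟨B, hB⟩ := isCompact_Icc.exists_bound_of_continuousOn
    (hg.continuous.continuousOn (s := Icc (-D) D))
  obtain ⟨K, hK⟩ := (hg.locallyLipschitz.locallyLipschitzOn (s := Icc (-D) D)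
    ).exists_lipschitzOnWith_of_compact isCompact_Icc
  refine ⟨max B K, fun p ↦ (hB _ (clamp_mem_Icc hD _)).trans (le_max_left _ _), fun p q ↦ ?_⟩
  calc |g (clamp D p.1) - g (clamp D q.1)| ≤ K * dist (clamp D p.1) (clamp D q.1) :=
        hK.dist_le_mul _ (clamp_mem_Icc hD _) _ (clamp_mem_Icc hD _)
    _ ≤ K * dist p q := by
        gcongr
        have h := (lipschitzWith_clamp D).dist_le_mul p.1 q.1
        rw [NNReal.coe_one, one_mul] at h
        exact h.trans (le_max_left _ _)
    _ ≤ max B K * dist p q := by gcongr; exact le_max_right _ _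

lemma lipschitzWith_sigmoid : LipschitzWith 1 Real.sigmoid := by
  refine lipschitzWith_of_nnnorm_deriv_le differentiable_sigmoid fun x ↦ ?_
  rw [← NNReal.coe_le_coe, coe_nnnorm, Real.deriv_sigmoid, Real.norm_eq_abs, NNReal.coe_one,
    abs_of_nonneg]
  · nlinarith [Real.sigmoid_nonneg x, Real.sigmoid_le_one x]
  · exact mul_nonneg (Real.sigmoid_nonneg x) (sub_nonneg.2 (Real.sigmoid_le_one x))

lemma boundedLipschitz_sigmoid_clamp (D a : ℝ) :
    BoundedLipschitz (fun p : ℝ × ℝ ↦ Real.sigmoid (-(3 * clamp D p.1 + 2 * p.2 + a))) := by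
  refine ⟨5, fun p ↦ ?_, fun p q ↦ ?_⟩
  · rw [abs_of_nonneg (Real.sigmoid_nonneg _)]
    linarith [Real.sigmoid_le_one (-(3 * clamp D p.1 + 2 * p.2 + a))]
  · have h := lipschitzWith_sigmoid.dist_le_mul (-(3 * clamp D p.1 + 2 * p.2 + a))
      (-(3 * clamp D q.1 + 2 * q.2 + a))
    have h₁ := (lipschitzWith_clamp D).dist_le_mul p.1 q.1
    rw [NNReal.coe_one, one_mul] at h h₁
    have h₂ : dist p.1 q.1 ≤ dist p q := le_max_left _ _
    have h₃ : dist p.2 q.2 ≤ dist p q := le_max_right _ _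
    simp only [Real.dist_eq] at h h₁ h₂ h₃
    refine h.trans ?_
    have h₄ := h₁.trans h₂
    rw [abs_le] at h₃ h₄ ⊢
    constructor <;> linarith [h₃.1, h₃.2, h₄.1, h₄.2]

/-- The `s`-derivative of `z`, where `s = log t`, `x = log (H / t)` and
`z = log (c t H' / H)`, when `H` solves (EL). -/
def elasticityRate (c γ z x : ℝ) : ℝ :=
  (1 - Real.exp z ^ 2) * (1 + γ * Real.exp z ^ 2 * Real.exp x ^ 2 / c ^ 2) /
    (1 + γ * Real.exp z ^ 3 * Real.exp x ^ 2 / c)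

/-- (EL) as an autonomous system for `(z, x)`, with `z` truncated to `[-D, D]`. -/
def truncatedField (c γ D : ℝ) (p : ℝ × ℝ) : ℝ × ℝ :=
  (elasticityRate c γ (clamp D p.1) p.2, Real.exp (clamp D p.1) / c - 1)

lemma elasticityRate_eq_sigmoid {c γ : ℝ} (hc : 0 < c) (hγ : 0 < γ) (z x : ℝ) :
    elasticityRate c γ z x = (1 - Real.exp z ^ 2) * Real.exp (-z) / c +
      (1 - Real.exp z ^ 2) * (1 - Real.exp (-z) / c) *
        Real.sigmoid (-(3 * z + 2 * x + Real.log (γ / c))) := by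
  have h : Real.exp (3 * z + 2 * x + Real.log (γ / c)) =
      γ * Real.exp z ^ 3 * Real.exp x ^ 2 / c := by
    rw [Real.exp_add, Real.exp_add, Real.exp_log (by positivity), ← Real.exp_nat_mul,
      ← Real.exp_nat_mul]
    push_cast
    ring
  have hden : 1 + γ * Real.exp z ^ 3 * Real.exp x ^ 2 / c ≠ 0 := by positivity
  rw [elasticityRate, Real.sigmoid_def, neg_neg, h, Real.exp_neg]
  have := (Real.exp_pos z).ne'
  field_simp
  ring

lemma exists_bound_truncatedField {c γ D : ℝ} (hc : 0 < c) (hγ : 0 < γ) (hD : 0 ≤ D) :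
    ∃ (K : NNReal) (B : ℝ), LipschitzWith K (truncatedField c γ D) ∧
      ∀ p, ‖truncatedField c γ D p‖ ≤ B := by
  have h₁ : BoundedLipschitz (fun p : ℝ × ℝ ↦ elasticityRate c γ (clamp D p.1) p.2) := by
    simp only [elasticityRate_eq_sigmoid hc hγ]
    exact (boundedLipschitz_comp_clamp
      (g := fun z ↦ (1 - Real.exp z ^ 2) * Real.exp (-z) / c) (by fun_prop) hD).add
      ((boundedLipschitz_comp_clamp
        (g := fun z ↦ (1 - Real.exp z ^ 2) * (1 - Real.exp (-z) / c)) (by fun_prop) hD).mul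
        (boundedLipschitz_sigmoid_clamp D _))
  obtain ⟨K, hK, hK'⟩ := h₁
  obtain ⟨L, hL, hL'⟩ := boundedLipschitz_comp_clamp
    (g := fun z ↦ Real.exp z / c - 1) (by fun_prop) hD
  refine ⟨(max K L).toNNReal, max K L, LipschitzWith.of_dist_le_mul fun p q ↦ ?_, fun p ↦ ?_⟩
  · refine max_le ((hK' p q).trans ?_) ((hL' p q).trans ?_)
    · gcongr
      exact (le_max_left _ _).trans (Real.le_coe_toNNReal _)
    · gcongr
      exact (le_max_right _ _).trans (Real.le_coe_toNNReal _)
  · exact max_le_max (hK p) (hL p)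

/-- `(z, x)` is a global integral curve of `truncatedField c γ D`. -/
structure IsTruncatedSolution (c γ D : ℝ) (z x : ℝ → ℝ) : Prop where
  hasDerivAt_fst : ∀ s, HasDerivAt z (elasticityRate c γ (clamp D (z s)) (x s)) s
  hasDerivAt_snd : ∀ s, HasDerivAt x (Real.exp (clamp D (z s)) / c - 1) s

lemma isTruncatedSolution_of_hasDerivAt {c γ D : ℝ} {f : ℝ → ℝ × ℝ}
    (hf : ∀ s, HasDerivAt f (truncatedField c γ D (f s)) s) :
    IsTruncatedSolution c γ D (fun s ↦ (f s).1) (fun s ↦ (f s).2) :=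
  ⟨fun s ↦ (hf s).fst, fun s ↦ (hf s).snd⟩

lemma elasticityRate_nonpos {c γ z : ℝ} (hc : 0 < c) (hγ : 0 < γ) (hz : 0 ≤ z) (x : ℝ) :
    elasticityRate c γ z x ≤ 0 := by
  have := Real.one_le_exp hz
  refine div_nonpos_of_nonpos_of_nonneg (mul_nonpos_of_nonpos_of_nonneg ?_ ?_) ?_
  · nlinarith
  all_goals positivity

lemma elasticityRate_nonneg {c γ z : ℝ} (hc : 0 < c) (hγ : 0 < γ) (hz : z ≤ 0) (x : ℝ) :
    0 ≤ elasticityRate c γ z x := by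
  have h₀ := Real.exp_pos z
  have := Real.exp_le_one_iff.2 hz
  refine div_nonneg (mul_nonneg ?_ ?_) ?_
  · nlinarith
  all_goals positivity

lemma elasticityRate_le {c γ z x b : ℝ} (hc : 0 < c) (hγ : 0 < γ) (hz : z ≤ 0) (hx : x ≤ b) :
    elasticityRate c γ z x ≤ 1 + γ * Real.exp b ^ 2 / c ^ 2 := by
  have h₀ := Real.exp_pos z
  have h₁ := Real.exp_le_one_iff.2 hz
  have h₂ : Real.exp z ^ 2 ≤ 1 := by nlinarith
  calc elasticityRate c γ z x
      ≤ (1 - Real.exp z ^ 2) * (1 + γ * Real.exp z ^ 2 * Real.exp x ^ 2 / c ^ 2) := by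
        refine div_le_self (mul_nonneg (by linarith) (by positivity)) ?_
        have : 0 ≤ γ * Real.exp z ^ 3 * Real.exp x ^ 2 / c := by positivity
        linarith
    _ ≤ 1 * (1 + γ * Real.exp z ^ 2 * Real.exp x ^ 2 / c ^ 2) := by
        gcongr
        nlinarith
    _ ≤ 1 + γ * 1 * Real.exp b ^ 2 / c ^ 2 := by
        rw [one_mul]
        gcongr
    _ = 1 + γ * Real.exp b ^ 2 / c ^ 2 := by rw [mul_one]

lemma neg_mul_exp_le_elasticityRate {c γ z x b : ℝ} (hc : 0 < c) (hγ : 0 < γ) (hx : b ≤ x) :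
    -((1 + c ^ 2 / (γ * Real.exp b ^ 2)) * (Real.exp z / c)) ≤ elasticityRate c γ z x := by
  rcases le_total z 0 with hz | hz
  · refine le_trans ?_ (elasticityRate_nonneg hc hγ hz x)
    rw [neg_nonpos]
    positivity
  · have hE := Real.one_le_exp hz
    have hV : Real.exp b ≤ Real.exp x := Real.exp_le_exp.2 hx
    have hb := Real.exp_pos b
    have hX := Real.exp_pos x
    rw [elasticityRate]
    generalize Real.exp z = E at *
    generalize Real.exp x = V at *
    generalize Real.exp b = β at *
    have hE0 : 0 < E := by linarith
    have hVβ : β ^ 2 ≤ V ^ 2 := by gcongr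
    have hEV : β ^ 2 ≤ E ^ 2 * V ^ 2 :=
      hVβ.trans (le_mul_of_one_le_left (sq_nonneg V) (one_le_pow₀ hE))
    rw [le_div_iff₀ (by positivity)]
    have h₁ : 1 + γ * E ^ 3 * V ^ 2 / c ≥ γ * E ^ 3 * V ^ 2 / c := by linarith
    have h₂ : E ^ 2 * (1 + γ * E ^ 2 * V ^ 2 / c ^ 2) ≤
        (1 + c ^ 2 / (γ * β ^ 2)) * (E / c) * (γ * E ^ 3 * V ^ 2 / c) := by
      have h₃ : (1 + c ^ 2 / (γ * β ^ 2)) * (E / c) * (γ * E ^ 3 * V ^ 2 / c) =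
          E ^ 2 * (E ^ 2 * V ^ 2 / β ^ 2 + γ * E ^ 2 * V ^ 2 / c ^ 2) := by
        field_simp
        ring
      rw [h₃]
      gcongr
      rwa [one_le_div (by positivity)]
    have h₄ : (1 + c ^ 2 / (γ * β ^ 2)) * (E / c) * (γ * E ^ 3 * V ^ 2 / c) ≤
        (1 + c ^ 2 / (γ * β ^ 2)) * (E / c) * (1 + γ * E ^ 3 * V ^ 2 / c) := by
      gcongr
    have h₅ : 0 ≤ 1 + γ * E ^ 2 * V ^ 2 / c ^ 2 := by positivity
    linarith

/-- The profile `H` with `log (H t / t) = x (log t)`. -/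
def profile (x : ℝ → ℝ) (t : ℝ) : ℝ := t * Real.exp (x (Real.log t))

lemma image_le_add_mul {f f' : ℝ → ℝ} {C S : ℝ} (hS : 0 ≤ S) (hf : ∀ s, HasDerivAt f (f' s) s)
    (hC : ∀ s ∈ Icc 0 S, f' s ≤ C) : f S ≤ f 0 + C * S := by
  have h := (convex_Icc 0 S).image_sub_le_mul_sub_of_deriv_le
    (fun s _ ↦ (hf s).continuousAt.continuousWithinAt)
    (fun s _ ↦ (hf s).differentiableAt.differentiableWithinAt) (C := C)
    (fun s hs ↦ (hf s).deriv ▸ hC s (interior_subset hs))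
    0 (left_mem_Icc.2 hS) S (right_mem_Icc.2 hS) hS
  linarith

lemma add_mul_le_image {f f' : ℝ → ℝ} {C S : ℝ} (hS : 0 ≤ S) (hf : ∀ s, HasDerivAt f (f' s) s)
    (hC : ∀ s ∈ Icc 0 S, C ≤ f' s) : f 0 + C * S ≤ f S := by
  have h := image_le_add_mul (C := -C) hS (fun s ↦ (hf s).neg) fun s hs ↦ neg_le_neg (hC s hs)
  simp only [Pi.neg_apply] at h
  linarith

namespace IsTruncatedSolution

variable {c γ D : ℝ} {z x : ℝ → ℝ}

lemma antitone_abs (h : IsTruncatedSolution c γ D z x) (hc : 0 < c) (hγ : 0 < γ) (hD : 0 ≤ D) :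
    Antitone fun s ↦ |z s| := by
  have hsq : Antitone fun s ↦ z s ^ 2 := by
    have hd : ∀ s, HasDerivAt (fun s ↦ z s ^ 2)
        (2 * z s * elasticityRate c γ (clamp D (z s)) (x s)) s := fun s ↦
      ((h.hasDerivAt_fst s).pow 2).congr_deriv (by simp)
    refine antitone_of_deriv_nonpos (fun s ↦ (hd s).differentiableAt) fun s ↦ ?_
    rw [(hd s).deriv]
    rcases le_total 0 (z s) with hz | hz
    · exact mul_nonpos_of_nonneg_of_nonpos (by positivity)
        (elasticityRate_nonpos hc hγ (clamp_nonneg_of_nonneg hD hz) _)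
    · exact mul_nonpos_of_nonpos_of_nonneg (by linarith)
        (elasticityRate_nonneg hc hγ (clamp_nonpos_of_nonpos hD hz) _)
  exact fun s t hst ↦ sq_le_sq.1 (hsq hst)

lemma abs_le (h : IsTruncatedSolution c γ D z x) (hc : 0 < c) (hγ : 0 < γ) (h₀ : |z 0| < D)
    {s : ℝ} (hs : 0 ≤ s) : |z s| ≤ |z 0| :=
  h.antitone_abs hc hγ ((abs_nonneg _).trans h₀.le) hs

lemma clamp_eq (h : IsTruncatedSolution c γ D z x) (hc : 0 < c) (hγ : 0 < γ) (h₀ : |z 0| < D)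
    {s : ℝ} (hs : 0 ≤ s) : clamp D (z s) = z s :=
  clamp_of_abs_le ((h.abs_le hc hγ h₀ hs).trans h₀.le)

lemma nonpos (h : IsTruncatedSolution c γ D z x) (hc : 0 < c) (hγ : 0 < γ) (hD : 0 ≤ D)
    (h₀ : z 0 ≤ 0) {s : ℝ} (hs : 0 ≤ s) : z s ≤ 0 := by
  by_contra! hpos
  have hcont : Continuous z :=
    continuous_iff_continuousAt.2 fun s ↦ (h.hasDerivAt_fst s).continuousAt
  obtain ⟨t, ht, hzt⟩ := intermediate_value_Icc hs hcont.continuousOn ⟨h₀, hpos.le⟩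
  have := h.antitone_abs hc hγ hD ht.2
  simp only [hzt, abs_zero] at this
  exact hpos.ne' (abs_nonpos_iff.1 this)

lemma hasDerivAt_add_snd (h : IsTruncatedSolution c γ D z x) (s : ℝ) :
    HasDerivAt (fun s ↦ s + x s) (Real.exp (clamp D (z s)) / c) s :=
  ((hasDerivAt_id s).add (h.hasDerivAt_snd s)).congr_deriv (by ring)

lemma monotone_add_snd (h : IsTruncatedSolution c γ D z x) (hc : 0 < c) :
    Monotone fun s ↦ s + x s := by
  refine monotone_of_deriv_nonneg (fun s ↦ (h.hasDerivAt_add_snd s).differentiableAt) fun s ↦ ?_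
  rw [(h.hasDerivAt_add_snd s).deriv]
  positivity

/-- Solutions with small initial slope grow slowly. -/
lemma add_snd_le (h : IsTruncatedSolution c γ D z x) (hc : 0 < c) (hγ : 0 < γ)
    (hD : |z 0| < D) (hz₀ : z 0 ≤ 0) (hx₀ : x 0 = 0) {S : ℝ} (hS : 0 ≤ S) :
    S + x S ≤ Real.exp (z 0 + (1 + γ * Real.exp (S / c) ^ 2 / c ^ 2) * S) / c * S := by
  have hz : ∀ s, 0 ≤ s → z s ≤ 0 := fun s hs ↦
    h.nonpos hc hγ ((abs_nonneg _).trans hD.le) hz₀ hs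
  have hx : ∀ s ∈ Icc 0 S, x s ≤ S / c := by
    intro s hs
    have hW := image_le_add_mul (C := 1 / c) hs.1 h.hasDerivAt_add_snd fun t ht ↦ by
      rw [h.clamp_eq hc hγ hD ht.1]
      gcongr
      exact Real.exp_le_one_iff.2 (hz t ht.1)
    have hs' : 1 / c * s ≤ S / c := by
      rw [div_mul_eq_mul_div, one_mul]
      gcongr
      exact hs.2
    simp only [hx₀] at hW
    linarith [hs.1]
  set K := 1 + γ * Real.exp (S / c) ^ 2 / c ^ 2 with hK
  have hK0 : 0 ≤ K := by positivity
  have hz' : ∀ s ∈ Icc 0 S, z s ≤ z 0 + K * S := by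
    intro s hs
    have := image_le_add_mul (C := K) hs.1 h.hasDerivAt_fst fun t ht ↦ by
      rw [h.clamp_eq hc hγ hD ht.1]
      exact elasticityRate_le hc hγ (hz t ht.1) (hx t ⟨ht.1, ht.2.trans hs.2⟩)
    have := mul_le_mul_of_nonneg_left hs.2 hK0
    linarith
  have := image_le_add_mul (C := Real.exp (z 0 + K * S) / c) hS h.hasDerivAt_add_snd
    fun t ht ↦ by
      rw [h.clamp_eq hc hγ hD ht.1]
      gcongr
      exact hz' t ht
  simpa [hx₀] using this

/-- Solutions with large initial slope grow fast. -/
lemma le_add_snd (h : IsTruncatedSolution c γ D z x) (hc : 0 < c) (hγ : 0 < γ)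
    (hD : |z 0| < D) (hx₀ : x 0 = 0) {S : ℝ} (hS : 0 ≤ S) :
    Real.exp (z 0 - (1 + c ^ 2 / (γ * Real.exp (-S) ^ 2)) * (S + x S)) / c * S ≤ S + x S := by
  have hW := h.monotone_add_snd hc
  have hx : ∀ s ∈ Icc 0 S, -S ≤ x s := by
    intro s hs
    have := hW hs.1
    simp only [hx₀] at this
    linarith [hs.2]
  set K := 1 + c ^ 2 / (γ * Real.exp (-S) ^ 2) with hK
  have hK0 : 0 ≤ K := by positivity
  have hz : ∀ s ∈ Icc 0 S, z 0 - K * (S + x S) ≤ z s := by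
    intro s hs
    have hd : ∀ t, HasDerivAt (fun t ↦ z t + K * (t + x t))
        (elasticityRate c γ (clamp D (z t)) (x t) + K * (Real.exp (clamp D (z t)) / c)) t :=
      fun t ↦ (h.hasDerivAt_fst t).add ((h.hasDerivAt_add_snd t).const_mul K)
    have h₁ := add_mul_le_image (C := 0) hs.1 hd fun t ht ↦ by
      have := neg_mul_exp_le_elasticityRate (z := clamp D (z t)) hc hγ
        (hx t ⟨ht.1, ht.2.trans hs.2⟩)
      linarith
    have h₂ := mul_le_mul_of_nonneg_left (hW hs.2) hK0
    simp only [hx₀] at h₁ h₂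
    linarith
  have := add_mul_le_image (C := Real.exp (z 0 - K * (S + x S)) / c) hS h.hasDerivAt_add_snd
    fun t ht ↦ by
      rw [h.clamp_eq hc hγ hD ht.1]
      gcongr
      exact hz t ht
  simpa [hx₀] using this

lemma hasDerivAt_profile (h : IsTruncatedSolution c γ D z x) {t : ℝ} (ht : 0 < t)
    (hz : |z (Real.log t)| ≤ D) :
    HasDerivAt (profile x) (Real.exp (x (Real.log t) + z (Real.log t)) / c) t := by
  have hx := (h.hasDerivAt_snd (Real.log t)).comp t (Real.hasDerivAt_log ht.ne')
  rw [clamp_of_abs_le hz] at hx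
  have := (hasDerivAt_id t).mul hx.exp
  refine this.congr_deriv ?_
  simp only [id, Function.comp, Real.exp_add]
  field_simp
  ring

lemma eventually_abs_le (h : IsTruncatedSolution c γ D z x) (hc : 0 < c) (hγ : 0 < γ)
    (h₀ : |z 0| < D) {t : ℝ} (ht : 1 ≤ t) :
    ∀ᶠ u in nhds t, 0 < u ∧ |z (Real.log u)| ≤ D := by
  have ht0 : 0 < t := by linarith
  have hcont : ContinuousAt (fun u ↦ |z (Real.log u)|) t :=
    ((h.hasDerivAt_fst _).continuousAt.comp (Real.continuousAt_log ht0.ne')).abs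
  filter_upwards [lt_mem_nhds ht0, hcont.eventually_lt continuousAt_const
    ((h.abs_le hc hγ h₀ (Real.log_nonneg ht)).trans_lt h₀)] with u hu hu'
  exact ⟨hu, hu'.le⟩

lemma deriv_profile (h : IsTruncatedSolution c γ D z x) (hc : 0 < c) (hγ : 0 < γ)
    (h₀ : |z 0| < D) {t : ℝ} (ht : 1 ≤ t) :
    deriv (profile x) t = Real.exp (x (Real.log t) + z (Real.log t)) / c :=
  let ⟨ht0, hz⟩ := (h.eventually_abs_le hc hγ h₀ ht).self_of_nhds
  (h.hasDerivAt_profile ht0 hz).deriv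

lemma differentiableAt_profile (h : IsTruncatedSolution c γ D z x) (hc : 0 < c) (hγ : 0 < γ)
    (h₀ : |z 0| < D) {t : ℝ} (ht : 1 ≤ t) : DifferentiableAt ℝ (profile x) t :=
  let ⟨ht0, hz⟩ := (h.eventually_abs_le hc hγ h₀ ht).self_of_nhds
  (h.hasDerivAt_profile ht0 hz).differentiableAt

lemma hasDerivAt_deriv_profile (h : IsTruncatedSolution c γ D z x) (hc : 0 < c) (hγ : 0 < γ)
    (h₀ : |z 0| < D) {t : ℝ} (ht : 1 ≤ t) :
    HasDerivAt (deriv (profile x)) (Real.exp (x (Real.log t) + z (Real.log t)) / c *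
      (Real.exp (z (Real.log t)) / c - 1 +
        elasticityRate c γ (z (Real.log t)) (x (Real.log t))) / t) t := by
  have hev : deriv (profile x) =ᶠ[nhds t]
      fun u ↦ Real.exp (x (Real.log u) + z (Real.log u)) / c := by
    filter_upwards [h.eventually_abs_le hc hγ h₀ ht] with u hu
    exact (h.hasDerivAt_profile hu.1 hu.2).deriv
  refine HasDerivAt.congr_of_eventuallyEq ?_ hev
  have hlog := Real.hasDerivAt_log (zero_lt_one.trans_le ht).ne'
  have hx := (h.hasDerivAt_snd (Real.log t)).comp t hlog
  have hz := (h.hasDerivAt_fst (Real.log t)).comp t hlog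
  rw [h.clamp_eq hc hγ h₀ (Real.log_nonneg ht)] at hx hz
  refine ((hx.add hz).exp.div_const c).congr_deriv ?_
  simp only [Function.comp, Pi.add_apply]
  ring

lemma solvesEL_profile (h : IsTruncatedSolution c γ D z x) (hc : 0 < c) (hγ : 0 < γ)
    (h₀ : |z 0| < D) : SolvesEL c γ (profile x) (Ici 1) := by
  intro t ht
  rw [mem_Ici] at ht
  have ht0 : 0 < t := by linarith
  rw [(h.hasDerivAt_deriv_profile hc hγ h₀ ht).deriv, h.deriv_profile hc hγ h₀ ht, profile,
    elasticityRate, Real.exp_add]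
  have hX := Real.exp_pos (x (Real.log t))
  have hZ := Real.exp_pos (z (Real.log t))
  generalize Real.exp (x (Real.log t)) = V at *
  generalize Real.exp (z (Real.log t)) = E at *
  have h₁ : c + γ * E ^ 3 * V ^ 2 ≠ 0 := by positivity
  have h₂ : t * V + c ^ 2 * γ * t * (V * E / c) ^ 3 = t * V * (c + γ * E ^ 3 * V ^ 2) / c := by
    field_simp
  have h₃ : 1 + γ * E ^ 3 * V ^ 2 / c = (c + γ * E ^ 3 * V ^ 2) / c := by
    field_simp
  rw [h₂, h₃]
  field_simp
  ring

lemma strictMonoOn_profile (h : IsTruncatedSolution c γ D z x) (hc : 0 < c) (hγ : 0 < γ)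
    (h₀ : |z 0| < D) : StrictMonoOn (profile x) (Ici 1) := by
  refine strictMonoOn_of_deriv_pos (convex_Ici 1)
    (fun t ht ↦ (h.differentiableAt_profile hc hγ h₀ ht).continuousAt.continuousWithinAt)
    fun t ht ↦ ?_
  rw [h.deriv_profile hc hγ h₀ (interior_subset ht)]
  positivity

lemma image_Icc_profile (h : IsTruncatedSolution c γ D z x) (hc : 0 < c) (hγ : 0 < γ)
    (h₀ : |z 0| < D) {r : ℝ} (hr : 1 ≤ r) :
    profile x '' Icc 1 r = Icc (profile x 1) (profile x r) := by
  refine Subset.antisymm ?_ (intermediate_value_Icc hr fun t ht ↦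
    (h.differentiableAt_profile hc hγ h₀ ht.1).continuousAt.continuousWithinAt)
  rintro _ ⟨t, ht, rfl⟩
  have hmono := (h.strictMonoOn_profile hc hγ h₀).monotoneOn
  exact ⟨hmono self_mem_Ici ht.1 ht.1, hmono ht.1 hr ht.2⟩

lemma profile_eq_exp {t : ℝ} (ht : 0 < t) :
    profile x t = Real.exp (Real.log t + x (Real.log t)) := by
  rw [profile, Real.exp_add, Real.exp_log ht]

lemma image_Ici_profile (h : IsTruncatedSolution c γ D z x) (hc : 0 < c) (hγ : 0 < γ)
    (h₀ : |z 0| < D) (hx₀ : x 0 = 0) : profile x '' Ici 1 = Ici 1 := by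
  have h1 : profile x 1 = 1 := by simp [profile, hx₀]
  refine Subset.antisymm ?_ fun R hR ↦ ?_
  · rintro _ ⟨t, ht, rfl⟩
    rw [mem_Ici, ← h1]
    exact (h.strictMonoOn_profile hc hγ h₀).monotoneOn self_mem_Ici ht ht
  · set δ := Real.exp (-|z 0|) / c with hδ
    have hδ0 : 0 < δ := by positivity
    have hS : 0 ≤ Real.log R / δ := div_nonneg (Real.log_nonneg hR) hδ0.le
    have hW := add_mul_le_image (C := δ) hS h.hasDerivAt_add_snd fun t ht ↦ by
      rw [h.clamp_eq hc hγ h₀ ht.1, hδ]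
      gcongr
      exact (neg_le_neg (h.abs_le hc hγ h₀ ht.1)).trans (neg_abs_le _)
    rw [hx₀, mul_div_cancel₀ _ hδ0.ne', add_zero, zero_add] at hW
    have ht : 1 ≤ Real.exp (Real.log R / δ) := Real.one_le_exp hS
    have hR' : R ≤ profile x (Real.exp (Real.log R / δ)) := by
      rw [profile_eq_exp (Real.exp_pos _), Real.log_exp]
      calc R = Real.exp (Real.log R) := (Real.exp_log (zero_lt_one.trans_le hR)).symm
        _ ≤ _ := Real.exp_le_exp.2 hW
    have hmem : R ∈ profile x '' Icc 1 (Real.exp (Real.log R / δ)) := by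
      rw [h.image_Icc_profile hc hγ h₀ ht, h1]
      exact ⟨hR, hR'⟩
    exact image_mono Icc_subset_Ici_self hmem

/-- The properties of the profile of a solution starting at `(z 0, 0)`. -/
lemma profile_spec (h : IsTruncatedSolution c γ D z x) (hc : 0 < c) (hγ : 0 < γ)
    (h₀ : |z 0| < D) (hx₀ : x 0 = 0) :
    profile x 1 = 1 ∧ deriv (profile x) 1 = Real.exp (z 0) / c ∧
      (∀ t ∈ Ici (1 : ℝ), DifferentiableAt ℝ (profile x) t ∧
        DifferentiableAt ℝ (deriv (profile x)) t) ∧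
      SolvesEL c γ (profile x) (Ici 1) ∧
      StrictMonoOn (profile x) (Ici 1) ∧ profile x '' Ici 1 = Ici 1 := by
  refine ⟨by simp [profile, hx₀], ?_, fun t ht ↦ ⟨h.differentiableAt_profile hc hγ h₀ ht,
    (h.hasDerivAt_deriv_profile hc hγ h₀ ht).differentiableAt⟩, h.solvesEL_profile hc hγ h₀,
    h.strictMonoOn_profile hc hγ h₀, h.image_Ici_profile hc hγ h₀ hx₀⟩
  rw [h.deriv_profile hc hγ h₀ le_rfl, Real.log_one, hx₀, zero_add]

end IsTruncatedSolution

/-- The truncated system has a global solution for each initial value `(z₀, 0)`, and its value at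
a fixed positive time depends continuously on `z₀`. -/
lemma exists_flow_truncatedField {c γ D : ℝ} (hc : 0 < c) (hγ : 0 < γ) (hD : 0 ≤ D) :
    ∃ z x : ℝ → ℝ → ℝ, (∀ z₀, z z₀ 0 = z₀ ∧ x z₀ 0 = 0 ∧
      IsTruncatedSolution c γ D (z z₀) (x z₀)) ∧ ∀ S, 0 ≤ S → Continuous fun z₀ ↦ x z₀ S := by
  obtain ⟨K, B, hK, hB⟩ := exists_bound_truncatedField hc hγ hD
  choose f hf₀ hf using fun z₀ : ℝ ↦
    exists_integralCurve_of_lipschitz_of_bounded hK hB (z₀, (0 : ℝ))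
  refine ⟨fun z₀ s ↦ (f z₀ s).1, fun z₀ s ↦ (f z₀ s).2, fun z₀ ↦ ⟨by simp [hf₀], by simp [hf₀],
    isTruncatedSolution_of_hasDerivAt (hf z₀)⟩, fun S hS ↦ continuous_snd.comp ?_⟩
  refine (LipschitzWith.of_dist_le_mul (K := (Real.exp (K * S)).toNNReal) fun a b ↦ ?_).continuous
  have hcont : ∀ a, ContinuousOn (f a) (Icc 0 S) := fun a t _ ↦
    (hf a t).continuousAt.continuousWithinAt
  have := dist_le_of_trajectories_ODE (v := fun _ ↦ truncatedField c γ D) (δ := dist a b)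
    (fun _ ↦ hK) (hcont a) (fun t _ ↦ (hf a t).hasDerivWithinAt) (hcont b)
    (fun t _ ↦ (hf b t).hasDerivWithinAt) (by rw [hf₀, hf₀, dist_prod_same_right])
    S (right_mem_Icc.2 hS)
  rwa [sub_zero, mul_comm, ← Real.coe_toNNReal _ (Real.exp_pos (K * S)).le] at this

/-- For `0 < c < 1`, `γ > 0`: for every `q > 0` there is a C² solution
`H_q` of (EL) on `[1,∞)` with `H_q(1) = 1`, `H_q'(1) = q`, which is an increasing
diffeomorphism of `[1,∞)` onto itself; and for all `r > 1`, `R > 1` there is `q > 0`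
with `H_q(r) = R`, i.e. the solution restricts to an increasing diffeomorphism of
`[1,r]` onto `[1,R]`. -/
theorem stmt15 (c γ : ℝ) (hc0 : 0 < c) (hc1 : c < 1) (hγ : 0 < γ) :
    (∀ q : ℝ, 0 < q → ∃ H : ℝ → ℝ,
      H 1 = 1 ∧ deriv H 1 = q ∧
      (∀ t ∈ Set.Ici (1 : ℝ), DifferentiableAt ℝ H t ∧ DifferentiableAt ℝ (deriv H) t) ∧
      SolvesEL c γ H (Set.Ici 1) ∧
      StrictMonoOn H (Set.Ici 1) ∧ H '' Set.Ici 1 = Set.Ici 1) ∧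
    (∀ r : ℝ, 1 < r → ∀ R : ℝ, 1 < R → ∃ q : ℝ, 0 < q ∧ ∃ H : ℝ → ℝ,
      H 1 = 1 ∧ deriv H 1 = q ∧
      (∀ t ∈ Set.Ici (1 : ℝ), DifferentiableAt ℝ H t ∧ DifferentiableAt ℝ (deriv H) t) ∧
      SolvesEL c γ H (Set.Ici 1) ∧
      StrictMonoOn H (Set.Ici 1) ∧ H '' Set.Ici 1 = Set.Ici 1 ∧
      H r = R ∧ H '' Set.Icc 1 r = Set.Icc 1 R) := by

  refine ⟨fun q hq ↦ ?_, fun r hr R hR ↦ ?_⟩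
  · have hD : |Real.log (c * q)| < |Real.log (c * q)| + 1 := lt_add_one _
    obtain ⟨z, x, hsol, -⟩ := exists_flow_truncatedField hc0 hγ ((abs_nonneg _).trans hD.le)
    obtain ⟨hz, hx, h⟩ := hsol (Real.log (c * q))
    have hspec := h.profile_spec hc0 hγ (by rwa [hz]) hx
    rw [hz, Real.exp_log (by positivity), mul_div_cancel_left₀ _ hc0.ne'] at hspec
    exact ⟨_, hspec⟩
  · have hS : 0 < Real.log r := Real.log_pos hr
    have hρ : 0 < Real.log R := Real.log_pos hR
    set S := Real.log r
    set ρ := Real.log R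
    set z₁ := min 0 (Real.log (c * ρ / S) - (1 + γ * Real.exp (S / c) ^ 2 / c ^ 2) * S) with hz₁
    set z₂ := Real.log (c * ρ / S) + (1 + c ^ 2 / (γ * Real.exp (-S) ^ 2)) * ρ with hz₂
    set D := max |z₁| |z₂| + 1
    have hD : ∀ z₀ ∈ uIcc z₁ z₂, |z₀| < D := fun z₀ hz₀ ↦
      (abs_le.2 (uIcc_subset_Icc (abs_le.1 (le_max_left _ _)) (abs_le.1 (le_max_right _ _))
        hz₀)).trans_lt (lt_add_one _)
    obtain ⟨z, x, hsol, hcont⟩ := exists_flow_truncatedField hc0 hγ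
      ((abs_nonneg _).trans (hD z₁ left_mem_uIcc).le)
    have hlow : S + x z₁ S ≤ ρ := by
      obtain ⟨hz, hx, h⟩ := hsol z₁
      refine (h.add_snd_le hc0 hγ (by rw [hz]; exact hD _ left_mem_uIcc)
        (by rw [hz]; exact min_le_left _ _) hx hS.le).trans ?_
      rw [hz]
      calc _ ≤ Real.exp (Real.log (c * ρ / S)) / c * S := by
            gcongr
            linarith [min_le_right 0
              (Real.log (c * ρ / S) - (1 + γ * Real.exp (S / c) ^ 2 / c ^ 2) * S)]
        _ = ρ := by
            rw [Real.exp_log (by positivity)]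
            field_simp
    have hhigh : ρ ≤ S + x z₂ S := by
      obtain ⟨hz, hx, h⟩ := hsol z₂
      by_contra! hlt
      refine hlt.not_ge (le_trans ?_ (h.le_add_snd hc0 hγ
        (by rw [hz]; exact hD _ right_mem_uIcc) hx hS.le))
      rw [hz]
      calc ρ = Real.exp (Real.log (c * ρ / S)) / c * S := by
            rw [Real.exp_log (by positivity)]
            field_simp
        _ ≤ _ := by
            gcongr
            have : (1 + c ^ 2 / (γ * Real.exp (-S) ^ 2)) * (S + x z₂ S) ≤
                (1 + c ^ 2 / (γ * Real.exp (-S) ^ 2)) * ρ := by gcongr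
            linarith
    obtain ⟨z₀, hz₀, hρ₀⟩ := intermediate_value_uIcc
      (continuous_const.add (hcont S hS.le)).continuousOn
      (Icc_subset_uIcc (⟨hlow, hhigh⟩ : ρ ∈ Icc (S + x z₁ S) (S + x z₂ S)))
    obtain ⟨hz, hx, h⟩ := hsol z₀
    have h₀ : |z z₀ 0| < D := by rw [hz]; exact hD _ hz₀
    have hHr : profile (x z₀) r = R := by
      rw [IsTruncatedSolution.profile_eq_exp (by linarith)]
      exact (congrArg Real.exp hρ₀).trans (Real.exp_log (by linarith))
    obtain ⟨h1, h2, h3, h4, h5, h6⟩ := h.profile_spec hc0 hγ h₀ hx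
    exact ⟨_, by positivity, profile (x z₀), h1, h2, h3, h4, h5, h6, hHr,
      by rw [h.image_Icc_profile hc0 hγ h₀ hr.le, h1, hHr]⟩

end
end

section
/- Let 0 < c < 1, γ > 0, r > 1, and let H be a strictly increasing C² solution of the ODE (EL) on [1,r] with H(1) = 1 and H'(1) = q where 0 < q < 1. Then H''(t) > 0 for all t ∈ [1,r], i.e. H is strictly convex. -/
open Set Filter

noncomputable section

/-- A function with positive derivative at `t` takes values below `F t` at points of `(a, t)`. -/
theorem exists_lt_of_hasDerivAt_pos {F : ℝ → ℝ} {a t f' : ℝ} (hF : HasDerivAt F f' t)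
    (hf' : 0 < f') (hat : a < t) : ∃ s ∈ Set.Ioo a t, F s < F t := by
  have hslope : ∀ᶠ s in nhdsWithin t (Set.Iio t), 0 < slope F t s :=
    ((hasDerivAt_iff_tendsto_slope.mp hF).mono_left
      (nhdsWithin_mono t fun s hs => ne_of_lt hs)).eventually (lt_mem_nhds hf')
  obtain ⟨s, hs, hst⟩ := (hslope.and (Ioo_mem_nhdsLT hat)).exists
  refine ⟨s, hst, ?_⟩
  rw [slope_def_field] at hs
  by_contra! h
  exact absurd hs (not_lt.mpr (div_nonpos_of_nonneg_of_nonpos (by linarith) (by linarith [hst.2])))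

/-- For `0 < c < 1`, `γ > 0`, `r > 1`, a strictly increasing C²
solution `H` of (EL) on `[1,r]` with `H(1) = 1` and `H'(1) = q ∈ (0,1)` is strictly
convex: `H''(t) > 0` on `[1,r]`. -/
theorem stmt16 (c γ r q : ℝ) (hc0 : 0 < c) (hc1 : c < 1) (hγ : 0 < γ) (hr : 1 < r)
    (hq0 : 0 < q) (hq1 : q < 1)
    (H : ℝ → ℝ) (hmono : StrictMonoOn H (Set.Icc 1 r))
    (hdiff : ∀ t ∈ Set.Icc 1 r, DifferentiableAt ℝ H t ∧ DifferentiableAt ℝ (deriv H) t)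
    (hEL : SolvesEL c γ H (Set.Icc 1 r))
    (hH1 : H 1 = 1) (hH'1 : deriv H 1 = q) :
    ∀ t ∈ Set.Icc 1 r, 0 < deriv (deriv H) t := by
  set u := deriv H with hu
  have hu0 : ∀ t ∈ Set.Icc 1 r, 0 ≤ u t := fun t ht => by
    rw [hu, ← (hdiff t ht).1.derivWithin (uniqueDiffOn_Icc hr t ht)]
    exact hmono.monotoneOn.derivWithin_nonneg
  have hH : ∀ t ∈ Set.Icc 1 r, 1 ≤ H t := fun t ht =>
    hH1 ▸ hmono.monotoneOn (Set.left_mem_Icc.mpr hr.le) ht ht.1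
  have hden : ∀ t ∈ Set.Icc 1 r, 0 < t * H t * (H t + c ^ 2 * γ * t * u t ^ 3) := fun t ht => by
    have ht0 : 0 < t := lt_of_lt_of_le one_pos ht.1
    have hHt : 0 < H t := lt_of_lt_of_le one_pos (hH t ht)
    have hut := hu0 t ht
    positivity
  have hfac : ∀ t ∈ Set.Icc 1 r, 0 < t + γ * H t * u t := fun t ht => by
    have ht0 : 0 < t := lt_of_lt_of_le one_pos ht.1
    have hHt : 0 < H t := lt_of_lt_of_le one_pos (hH t ht)
    have hut := hu0 t ht
    positivity
  set F : ℝ → ℝ := fun t => H t - c ^ 2 * t * u t with hF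
  have hFderiv : ∀ t ∈ Set.Icc 1 r,
      HasDerivAt F (u t - (c ^ 2 * u t + c ^ 2 * t * deriv u t)) t := fun t ht => by
    have hlin : HasDerivAt (fun x : ℝ => c ^ 2 * x) (c ^ 2) t := by
      simpa using (hasDerivAt_id t).const_mul (c ^ 2)
    exact (hdiff t ht).1.hasDerivAt.sub (hlin.mul (hdiff t ht).2.hasDerivAt)
  -- As long as `F` is positive, `u` is increasing and hence stays above its initial value.
  have hq : ∀ b ∈ Set.Icc 1 r, (∀ t ∈ Set.Ico 1 b, 0 < F t) → q ≤ u b := fun b hb hpos => by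
    have hsub : Set.Icc 1 b ⊆ Set.Icc 1 r := Set.Icc_subset_Icc_right hb.2
    have hmon : MonotoneOn u (Set.Icc 1 b) := by
      refine monotoneOn_of_deriv_nonneg (convex_Icc 1 b)
        (fun t ht => (hdiff t (hsub ht)).2.continuousAt.continuousWithinAt)
        (fun t ht => (hdiff t (hsub (interior_subset ht))).2.differentiableWithinAt) ?_
      intro t ht
      rw [interior_Icc] at ht
      have htr := hsub (Set.Ioo_subset_Icc_self ht)
      rw [hEL t htr]
      exact div_nonneg (mul_nonneg (mul_nonneg (sq_nonneg _) (hpos t ⟨ht.1.le, ht.2⟩).le)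
        (hfac t htr).le) (hden t htr).le
    exact hH'1 ▸ hmon (Set.left_mem_Icc.mpr hb.1) (Set.right_mem_Icc.mpr hb.1) hb.1
  have hc2 : c ^ 2 < 1 := by nlinarith
  have hFpos : ∀ t ∈ Set.Icc 1 r, 0 < F t := by
    by_contra! hne
    have hcont : ContinuousOn F (Set.Icc 1 r) :=
      fun t ht => (hFderiv t ht).continuousAt.continuousWithinAt
    have hcomp : IsCompact (Set.Icc 1 r ∩ F ⁻¹' Set.Iic 0) :=
      isCompact_Icc.of_isClosed_subset (hcont.preimage_isClosed_of_isClosed isClosed_Icc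
        isClosed_Iic) Set.inter_subset_left
    obtain ⟨b, ⟨hb, hFb⟩, hmin⟩ := hcomp.exists_isLeast hne
    have hbefore : ∀ t ∈ Set.Ico 1 b, 0 < F t := fun t ht => by
      by_contra! h
      exact absurd (hmin ⟨⟨ht.1, ht.2.le.trans hb.2⟩, h⟩) (not_le.mpr ht.2)
    have hub : 0 < u b := hq0.trans_le (hq b hb hbefore)
    have hF1 : 0 < F 1 := by
      simp only [hF, hH1, hH'1]
      nlinarith
    have hb1 : 1 < b := lt_of_le_of_ne hb.1 (by rintro rfl; exact absurd hFb (not_le.mpr hF1))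
    have hu'b : deriv u b ≤ 0 := by
      rw [hEL b hb]
      exact div_nonpos_of_nonpos_of_nonneg (mul_nonpos_of_nonpos_of_nonneg
        (mul_nonpos_of_nonneg_of_nonpos (sq_nonneg _) hFb) (hfac b hb).le) (hden b hb).le
    have hF'b : 0 < u b - (c ^ 2 * u b + c ^ 2 * b * deriv u b) := by
      have h1 : c ^ 2 * b * deriv u b ≤ 0 :=
        mul_nonpos_of_nonneg_of_nonpos (by positivity) hu'b
      nlinarith
    obtain ⟨s, hs, hlt⟩ := exists_lt_of_hasDerivAt_pos (hFderiv b hb) hF'b hb1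
    exact absurd (hlt.trans_le hFb) (not_lt.mpr (hbefore s ⟨hs.1.le, hs.2⟩).le)
  intro t ht
  have hut : 0 < u t :=
    hq0.trans_le (hq t ht fun s hs => hFpos s ⟨hs.1, hs.2.le.trans ht.2⟩)
  rw [hEL t ht]
  exact div_pos (mul_pos (mul_pos (pow_pos hut 2) (hFpos t ht)) (hfac t ht)) (hden t ht)

end
end

section
/- Let 0 < c < 1, γ > 0, r > 1, and let H be an increasing C² diffeomorphism of [1,r] onto [1,R] (H(1) = 1, H(r) = R) solving the ODE (EL) and satisfying the concavity condition c² t H'(t) ≥ H(t) for all t ∈ [1,r]. Then R ≥ r^{1/c²}, and moreover c² > (R/r)·((r − 1)/(R − 1)), equivalently r < 1/(1 − c² + c²/R). -/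
open Set Filter

noncomputable section

/-- A solution of (EL) satisfying the concavity condition is strictly concave: its derivative is
strictly decreasing. -/
lemma SolvesEL.strictAntiOn_deriv {c γ r : ℝ} {H : ℝ → ℝ} (hc0 : 0 < c) (hc1 : c < 1)
    (hγ : 0 < γ) (hpos : ∀ t ∈ Set.Icc 1 r, 0 < H t)
    (hdiff : ∀ t ∈ Set.Icc 1 r, DifferentiableAt ℝ H t ∧ DifferentiableAt ℝ (deriv H) t)
    (hEL : SolvesEL c γ H (Set.Icc 1 r))
    (hconc : ∀ t ∈ Set.Icc 1 r, H t ≤ c ^ 2 * t * deriv H t) :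
    StrictAntiOn (deriv H) (Set.Icc 1 r) := by
  refine strictAntiOn_of_deriv_neg (convex_Icc 1 r)
    (fun t ht => (hdiff t ht).2.continuousAt.continuousWithinAt) fun t ht => ?_
  have hti := interior_subset ht
  have ht0 : 0 < t := one_pos.trans_le hti.1
  have hH := hpos t hti
  have hH' : 0 < deriv H t :=
    pos_of_mul_pos_right (hH.trans_le (hconc t hti)) (by positivity)
  -- Equality in the concavity condition would be an interior minimum of `c² t H' - H`.
  have hlt : H t < c ^ 2 * t * deriv H t := by
    refine (hconc t hti).lt_of_ne fun heq => ?_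
    have hmin : IsLocalMin (fun s => c ^ 2 * s * deriv H s - H s) t := by
      filter_upwards [mem_interior_iff_mem_nhds.1 ht] with s hs
      linarith [hconc s hs]
    have hder := (((hasDerivAt_id t).const_mul (c ^ 2)).mul
      (hdiff t hti).2.hasDerivAt).sub (hdiff t hti).1.hasDerivAt
    have hzero := hmin.hasDerivAt_eq_zero hder
    have hsecond : deriv (deriv H) t = 0 := by
      rw [hEL t hti, ← heq]
      simp
    simp only [hsecond, id] at hzero
    have : c ^ 2 < 1 := by nlinarith
    nlinarith
  rw [hEL t hti]
  refine div_neg_of_neg_of_pos ?_ (by positivity)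
  exact mul_neg_of_neg_of_pos (mul_neg_of_pos_of_neg (by positivity) (by linarith))
    (by positivity)

/-- If `H ≤ c² t H'` on `[1, r]` and `H 1 = 1`, then `r ^ (1 / c²) ≤ H r`. -/
lemma rpow_le_of_le_mul_deriv {c r : ℝ} {H : ℝ → ℝ} (hc0 : 0 < c) (hr : 1 ≤ r) (hH1 : H 1 = 1)
    (hpos : ∀ t ∈ Set.Icc 1 r, 0 < H t)
    (hdiff : ∀ t ∈ Set.Icc 1 r, DifferentiableAt ℝ H t)
    (hconc : ∀ t ∈ Set.Icc 1 r, H t ≤ c ^ 2 * t * deriv H t) :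
    r ^ (1 / c ^ 2) ≤ H r := by
  have hder : ∀ t ∈ Set.Icc 1 r, HasDerivAt (fun s => c ^ 2 * Real.log (H s) - Real.log s)
      (c ^ 2 * (deriv H t / H t) - t⁻¹) t := fun t ht =>
    (((hdiff t ht).hasDerivAt.log (hpos t ht).ne').const_mul (c ^ 2)).sub
      (Real.hasDerivAt_log (one_pos.trans_le ht.1).ne')
  have hmon : MonotoneOn (fun s => c ^ 2 * Real.log (H s) - Real.log s) (Set.Icc 1 r) := by
    refine monotoneOn_of_deriv_nonneg (convex_Icc 1 r)
      (fun t ht => (hder t ht).continuousAt.continuousWithinAt)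
      (fun t ht => (hder t (interior_subset ht)).differentiableAt.differentiableWithinAt)
      fun t ht => ?_
    have hti := interior_subset ht
    have ht0 : 0 < t := one_pos.trans_le hti.1
    have hH := hpos t hti
    rw [(hder t hti).deriv, sub_nonneg, inv_eq_one_div, ← mul_div_assoc, div_le_div_iff₀ ht0 hH]
    linarith [hconc t hti]
  have hle := hmon (Set.left_mem_Icc.2 hr) (Set.right_mem_Icc.2 hr) hr
  simp only [hH1, Real.log_one, mul_zero, sub_zero, sub_nonneg] at hle
  have hr0 : 0 < r := one_pos.trans_le hr
  rw [← Real.log_le_log_iff (by positivity) (hpos r (Set.right_mem_Icc.2 hr)),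
    Real.log_rpow hr0, one_div, inv_mul_le_iff₀ (by positivity)]
  exact hle

/-- For `0 < c < 1`, `γ > 0`, `r > 1`, if `H` is an increasing C²
diffeomorphism of `[1,r]` onto `[1,R]` solving (EL) and satisfying the concavity
condition `c² t H'(t) ≥ H(t)` on `[1,r]`, then `R ≥ r^{1/c²}` and
`c² > (R/r)·((r − 1)/(R − 1))`, equivalently `r < 1/(1 − c² + c²/R)`. -/
theorem stmt18 (c γ r R : ℝ) (hc0 : 0 < c) (hc1 : c < 1) (hγ : 0 < γ) (hr : 1 < r)
    (H : ℝ → ℝ) (hH1 : H 1 = 1) (hHr : H r = R)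
    (hmono : StrictMonoOn H (Set.Icc 1 r))
    (himg : H '' Set.Icc 1 r = Set.Icc 1 R)
    (hdiff : ∀ t ∈ Set.Icc 1 r, DifferentiableAt ℝ H t ∧ DifferentiableAt ℝ (deriv H) t)
    (hEL : SolvesEL c γ H (Set.Icc 1 r))
    (hconc : ∀ t ∈ Set.Icc 1 r, H t ≤ c ^ 2 * t * deriv H t) :
    r ^ (1 / c ^ 2) ≤ R ∧ (R / r) * ((r - 1) / (R - 1)) < c ^ 2 ∧
      r < 1 / (1 - c ^ 2 + c ^ 2 / R) := by
  subst hHr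
  have h1 : (1 : ℝ) ∈ Set.Icc 1 r := Set.left_mem_Icc.2 hr.le
  have hrr : r ∈ Set.Icc 1 r := Set.right_mem_Icc.2 hr.le
  have hpos : ∀ t ∈ Set.Icc 1 r, 0 < H t := fun t ht =>
    one_pos.trans_le (hH1 ▸ hmono.monotoneOn h1 ht ht.1)
  have hR : 1 < H r := hH1 ▸ hmono h1 hrr hr
  have hr0 : 0 < r := one_pos.trans hr
  have hR0 : 0 < H r := one_pos.trans hR
  have hanti := hEL.strictAntiOn_deriv hc0 hc1 hγ hpos hdiff hconc
  obtain ⟨ξ, hξ, hslope⟩ := exists_deriv_eq_slope H hr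
    (fun t ht => (hdiff t ht).1.continuousAt.continuousWithinAt)
    (fun t ht => (hdiff t (Set.Ioo_subset_Icc_self ht)).1.differentiableWithinAt)
  have hlt : deriv H r < (H r - 1) / (r - 1) := by
    have := hanti (Set.Ioo_subset_Icc_self hξ) hrr hξ.2
    rwa [hslope, hH1] at this
  have hkey : H r * (r - 1) < c ^ 2 * (r * (H r - 1)) := by
    rw [lt_div_iff₀ (sub_pos.2 hr)] at hlt
    calc H r * (r - 1) ≤ c ^ 2 * r * deriv H r * (r - 1) :=
          mul_le_mul_of_nonneg_right (hconc r hrr) (sub_pos.2 hr).le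
      _ = c ^ 2 * r * (deriv H r * (r - 1)) := by ring
      _ < c ^ 2 * r * (H r - 1) := mul_lt_mul_of_pos_left hlt (by positivity)
      _ = c ^ 2 * (r * (H r - 1)) := by ring
  refine ⟨rpow_le_of_le_mul_deriv hc0 hr.le hH1 hpos (fun t ht => (hdiff t ht).1) hconc, ?_, ?_⟩
  · rwa [div_mul_div_comm, div_lt_iff₀ (mul_pos hr0 (sub_pos.2 hR))]
  · have hc2 : 0 < 1 - c ^ 2 := by nlinarith
    rw [lt_div_iff₀ (by positivity), ← mul_lt_mul_iff_left₀ hR0]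
    field_simp
    linarith

end
end
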